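/- arXiv:2302.10218 — 14 statements merged into one kernel-verified Lean document; each statement's English description precedes it below -/
import Mathlib

section
/- Let f be an unbounded modulus function, θ = (k_r) a lacunary sequence with h_r = k_r − k_{r−1} and I_r = (k_{r−1}, k_r], X a normed space, and (x_n) a sequence in X. If (x_n) is lacunary f-strong Cesàro convergent to some L ∈ X, i.e. lim_{r→∞} f(Σ_{k∈I_r} ‖x_k − L‖)/f(h_r) = 0, then (x_n) is lacunary strong Cesàro convergent to L, i.e. lim_{r→∞} (1/h_r) Σ_{k∈I_r} ‖x_k − L‖ = 0. -/
open Filter Topology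
open scoped Classical BigOperators

/-- A modulus function `f : ℝ → ℝ`, viewed on `[0, ∞)`: it vanishes exactly at `0`,
is subadditive, increasing, and continuous from the right at `0`. -/
def IsModulusFunction (f : ℝ → ℝ) : Prop :=
  (∀ x : ℝ, 0 ≤ x → 0 ≤ f x) ∧
  (∀ x : ℝ, 0 ≤ x → (f x = 0 ↔ x = 0)) ∧
  (∀ x y : ℝ, 0 ≤ x → 0 ≤ y → f (x + y) ≤ f x + f y) ∧
  (∀ x y : ℝ, 0 ≤ x → x ≤ y → f x ≤ f y) ∧
  ContinuousWithinAt f (Set.Ici 0) 0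

/-- An unbounded modulus function. -/
def IsUnboundedModulus (f : ℝ → ℝ) : Prop :=
  IsModulusFunction f ∧ ∀ M : ℝ, ∃ x : ℝ, 0 ≤ x ∧ M ≤ f x

/-- `θ = (k_r)` is a lacunary sequence: increasing, `k_0 = 0`, and
`h_r = k_r - k_{r-1} → ∞`. -/
def IsLacunary (θ : ℕ → ℕ) : Prop :=
  θ 0 = 0 ∧ StrictMono θ ∧ Tendsto (fun r => θ r - θ (r - 1)) atTop atTop

/-- `h_r = k_r - k_{r-1}`. -/
def hgap (θ : ℕ → ℕ) (r : ℕ) : ℕ := θ r - θ (r - 1)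

/-- `I_r = (k_{r-1}, k_r]` as a finite set of naturals. -/
def Ilac (θ : ℕ → ℕ) (r : ℕ) : Finset ℕ := Finset.Ioc (θ (r - 1)) (θ r)

/-- The ratios `q_r = k_r / k_{r-1}`, valued in `ℝ≥0∞`. -/
noncomputable def qratio (θ : ℕ → ℕ) (r : ℕ) : ENNReal :=
  (θ r : ENNReal) / (θ (r - 1) : ENNReal)

/-- Lacunary strong Cesàro convergence of `(x_n)` to `L`:
`(1/h_r) Σ_{k ∈ I_r} ‖x_k - L‖ → 0`. -/
def LacStrongCesaro {X : Type*} [NormedAddCommGroup X] (θ : ℕ → ℕ) (x : ℕ → X) (L : X) : Prop :=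
  Tendsto (fun r : ℕ => (∑ k ∈ Ilac θ r, ‖x k - L‖) / (hgap θ r : ℝ)) atTop (𝓝 0)

/-- Lacunary `f`-strong Cesàro convergence of `(x_n)` to `L`:
`f (Σ_{k ∈ I_r} ‖x_k - L‖) / f (h_r) → 0`. -/
def LacFStrongCesaro (f : ℝ → ℝ) {X : Type*} [NormedAddCommGroup X] (θ : ℕ → ℕ)
    (x : ℕ → X) (L : X) : Prop :=
  Tendsto (fun r : ℕ => f (∑ k ∈ Ilac θ r, ‖x k - L‖) / f (hgap θ r : ℝ)) atTop (𝓝 0)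

/-- Lacunary statistical convergence of `(x_n)` to `L`:
for every `ε > 0`, `(1/h_r) · #{k ∈ I_r : ‖x_k - L‖ > ε} → 0`. -/
def LacStatConv {X : Type*} [NormedAddCommGroup X] (θ : ℕ → ℕ) (x : ℕ → X) (L : X) : Prop :=
  ∀ ε : ℝ, 0 < ε →
    Tendsto (fun r : ℕ =>
      ((((Ilac θ r).filter fun k => ε < ‖x k - L‖).card : ℝ)) / (hgap θ r : ℝ)) atTop (𝓝 0)

/-- Lacunary `f`-statistical convergence of `(x_n)` to `L`:
for every `ε > 0`, `f (#{k ∈ I_r : ‖x_k - L‖ > ε}) / f (h_r) → 0`. -/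
def LacFStatConv (f : ℝ → ℝ) {X : Type*} [NormedAddCommGroup X] (θ : ℕ → ℕ)
    (x : ℕ → X) (L : X) : Prop :=
  ∀ ε : ℝ, 0 < ε →
    Tendsto (fun r : ℕ =>
      f ((((Ilac θ r).filter fun k => ε < ‖x k - L‖).card : ℝ)) / f (hgap θ r : ℝ)) atTop (𝓝 0)

/-- `θ`-compatibility of `f`: `limsup_r f(h_r ε) / f(h_r) → 0` as `ε → 0⁺`. -/
def ThetaCompatible (f : ℝ → ℝ) (θ : ℕ → ℕ) : Prop :=
  Tendsto (fun ε : ℝ =>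
      Filter.limsup (fun r : ℕ => f ((hgap θ r : ℝ) * ε) / f (hgap θ r : ℝ)) atTop)
    (𝓝[>] (0 : ℝ)) (𝓝 0)

/-- Compatibility of `f`: `limsup_n f(n ε) / f(n) → 0` as `ε → 0⁺`. -/
def Compatible (f : ℝ → ℝ) : Prop :=
  Tendsto (fun ε : ℝ =>
      Filter.limsup (fun n : ℕ => f ((n : ℝ) * ε) / f (n : ℝ)) atTop)
    (𝓝[>] (0 : ℝ)) (𝓝 0)

/-- `f`-strong Cesàro convergence of `(x_n)` to `L`:
`f (Σ_{k=1}^n ‖x_k - L‖) / f (n) → 0`. -/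
def FStrongCesaro (f : ℝ → ℝ) {X : Type*} [NormedAddCommGroup X] (x : ℕ → X) (L : X) : Prop :=
  Tendsto (fun n : ℕ => f (∑ k ∈ Finset.Icc 1 n, ‖x k - L‖) / f (n : ℝ)) atTop (𝓝 0)

/-- Lacunary uniform integrability of `(x_n)`:
`sup_r (1/h_r) Σ_{k ∈ I_r, ‖x_k‖ ≥ M} ‖x_k‖ → 0` as `M → ∞`
(the supremum is taken in `ℝ≥0∞` to avoid junk values). -/
def LacUnifInt {X : Type*} [NormedAddCommGroup X] (θ : ℕ → ℕ) (x : ℕ → X) : Prop :=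
  Tendsto (fun M : ℝ =>
      ⨆ r : ℕ, ENNReal.ofReal
        ((∑ k ∈ (Ilac θ r).filter fun k => M ≤ ‖x k‖, ‖x k‖) / (hgap θ r : ℝ)))
    atTop (𝓝 0)

/-- Lacunary `f`-strong Cesàro convergence implies lacunary strong Cesàro convergence. -/
theorem stmt0 {X : Type*} [NormedAddCommGroup X] [NormedSpace ℝ X]
    (f : ℝ → ℝ) (hf : IsUnboundedModulus f) (θ : ℕ → ℕ) (hθ : IsLacunary θ)
    (x : ℕ → X) (L : X) (h : LacFStrongCesaro f θ x L) :
    LacStrongCesaro θ x L := by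
  obtain ⟨⟨h0, hz, hadd, hmono, -⟩, -⟩ := hf
  have hmul : ∀ (n : ℕ) (y : ℝ), 0 ≤ y → f (n * y) ≤ n * f y := by
    intro n y hy
    induction n with
    | zero => simp [(hz 0 le_rfl).2 rfl]
    | succ n ih =>
      have := hadd (n * y) y (by positivity) hy
      push_cast
      rw [add_mul, one_mul, add_mul, one_mul]
      linarith
  unfold LacStrongCesaro
  unfold LacFStrongCesaro at h
  have hgt : Tendsto (fun r => hgap θ r) atTop atTop := hθ.2.2
  rw [Metric.tendsto_atTop'] at h ⊢
  intro ε hε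
  obtain ⟨n, hn⟩ := exists_nat_one_div_lt hε
  obtain ⟨R, hR⟩ := h (1 / ((n : ℝ) + 1)) (by positivity)
  obtain ⟨R', hR'⟩ := eventually_atTop.1 (hgt.eventually_ge_atTop 1)
  refine ⟨max R R', fun r hr => ?_⟩
  have h1 := hR r (lt_of_le_of_lt (le_max_left _ _) hr)
  have h2 := hR' r (le_of_lt (lt_of_le_of_lt (le_max_right _ _) hr))
  have hS : 0 ≤ ∑ k ∈ Ilac θ r, ‖x k - L‖ := Finset.sum_nonneg fun _ _ => norm_nonneg _
  generalize (∑ k ∈ Ilac θ r, ‖x k - L‖) = S at *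
  have hH : (0 : ℝ) < (hgap θ r : ℝ) := by exact_mod_cast h2
  generalize (hgap θ r : ℝ) = H at *
  have hfH : 0 < f H := lt_of_le_of_ne (h0 H hH.le) fun e => hH.ne' ((hz H hH.le).1 e.symm)
  have hn1 : (0 : ℝ) < (n : ℝ) + 1 := by positivity
  rw [Real.dist_eq, sub_zero, abs_of_nonneg (div_nonneg (h0 S hS) hfH.le),
    div_lt_div_iff₀ hfH hn1] at h1
  rw [Real.dist_eq, sub_zero, abs_of_nonneg (div_nonneg hS hH.le)]
  refine lt_trans ?_ hn
  rw [div_lt_div_iff₀ hH hn1]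
  by_contra hc
  push Not at hc
  have h3 := hmono H (((n + 1 : ℕ) : ℝ) * S) hH.le (by push_cast; linarith)
  have h4 := hmul (n + 1) S hS
  push_cast at h3 h4
  linarith
end

section
/- Let f be an unbounded modulus function, θ = (k_r) a lacunary sequence with h_r = k_r − k_{r−1} and I_r = (k_{r−1}, k_r], X a normed space, and (x_n) a sequence in X. If (x_n) is lacunary f-statistically convergent to L ∈ X, i.e. for every ε > 0, lim_{r→∞} f(#{k ∈ I_r : ‖x_k − L‖ > ε})/f(h_r) = 0, then (x_n) is lacunary statistically convergent to L, i.e. for every ε > 0, lim_{r→∞} (1/h_r) · #{k ∈ I_r : ‖x_k − L‖ > ε} = 0. -/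
open Filter Topology
open scoped Classical BigOperators

lemma modulus_nat_mul (f : ℝ → ℝ) (hf : IsModulusFunction f) (n : ℕ) (y : ℝ) (hy : 0 ≤ y) :
    f (n * y) ≤ n * f y := by
  obtain ⟨h0, hz, hs, hm, -⟩ := hf
  induction n with
  | zero => simp [(hz 0 le_rfl).2 rfl]
  | succ n ih =>
    have := hs (n * y) y (by positivity) hy
    push_cast
    rw [add_mul, one_mul]
    linarith

/-- Lacunary `f`-statistical convergence implies lacunary statistical convergence. -/
theorem stmt1 {X : Type*} [NormedAddCommGroup X] [NormedSpace ℝ X]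
    (f : ℝ → ℝ) (hf : IsUnboundedModulus f) (θ : ℕ → ℕ) (hθ : IsLacunary θ)
    (x : ℕ → X) (L : X) (h : LacFStatConv f θ x L) :
    LacStatConv θ x L := by
  intro ε hε
  have h1 := h ε hε
  have hmod := hf.1
  obtain ⟨h0, hz, hs, hm, -⟩ := hf.1
  have hg : Tendsto (hgap θ) atTop atTop := hθ.2.2
  rw [Metric.tendsto_atTop'] at h1 ⊢
  intro δ hδ
  obtain ⟨p, hp⟩ := exists_nat_one_div_lt hδ
  have hp0 : (0 : ℝ) < (p : ℝ) + 1 := by positivity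
  obtain ⟨N, hN⟩ := h1 (1 / ((p : ℝ) + 1)) (by positivity)
  obtain ⟨M, hM⟩ := eventually_atTop.1 (hg.eventually_gt_atTop 0)
  refine ⟨max N M, fun r hr => ?_⟩
  have hNr := hN r (lt_of_le_of_lt (le_max_left _ _) hr)
  have hMr := hM r ((le_max_right _ _).trans hr.le)
  generalize ((Ilac θ r).filter fun k => ε < ‖x k - L‖).card = c at *
  generalize hgap θ r = d at *
  have hd : (0 : ℝ) < d := by exact_mod_cast hMr
  have hc : (0 : ℝ) ≤ c := by positivity
  have hfd : 0 < f d := lt_of_le_of_ne (h0 _ hd.le) (fun e => hd.ne' ((hz _ hd.le).1 e.symm))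
  rw [Real.dist_eq, sub_zero, abs_of_nonneg (div_nonneg (h0 _ hc) hfd.le),
    div_lt_div_iff₀ hfd hp0] at hNr
  rw [Real.dist_eq, sub_zero, abs_of_nonneg (div_nonneg hc hd.le)]
  refine lt_trans ?_ hp
  rw [div_lt_div_iff₀ hd hp0]
  by_contra hcon
  push Not at hcon
  have h2 := hm d (((p + 1 : ℕ) : ℝ) * c) hd.le (by push_cast; linarith)
  have h3 := modulus_nat_mul f hmod (p + 1) c hc
  push_cast at h2 h3
  linarith
end

section
/- Let f be an unbounded modulus function and θ = (k_r) a lacunary sequence with h_r = k_r − k_{r−1} and I_r = (k_{r−1}, k_r]. Assume f is θ-compatible, i.e. lim_{ε→0⁺} limsup_{r→∞} f(h_r ε)/f(h_r) = 0. Then for any normed space X and any sequence (x_n) in X, if (x_n) is lacunary statistically convergent to L ∈ X (for every ε > 0, lim_{r→∞} (1/h_r) · #{k ∈ I_r : ‖x_k − L‖ > ε} = 0), then (x_n) is lacunary f-statistically convergent to L (for every ε > 0, lim_{r→∞} f(#{k ∈ I_r : ‖x_k − L‖ > ε})/f(h_r) = 0). -/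
open Filter Topology
open scoped Classical BigOperators

/-- If `f` is `θ`-compatible, lacunary statistical convergence implies
lacunary `f`-statistical convergence. -/
theorem stmt2 {X : Type*} [NormedAddCommGroup X] [NormedSpace ℝ X]
    (f : ℝ → ℝ) (hf : IsUnboundedModulus f) (θ : ℕ → ℕ) (hθ : IsLacunary θ)
    (hcomp : ThetaCompatible f θ)
    (x : ℕ → X) (L : X) (h : LacStatConv θ x L) :
    LacFStatConv f θ x L := by
  obtain ⟨⟨hnn, hz, -, hmono, -⟩, -⟩ := hf
  intro ε hε
  have hst := h ε hε
  rw [Metric.tendsto_nhds]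
  intro δ hδ
  have h1 : ∀ᶠ e in 𝓝[>] (0:ℝ), limsup (fun r : ℕ =>
      f ((hgap θ r : ℝ) * e) / f (hgap θ r : ℝ)) atTop < δ :=
    hcomp.eventually (gt_mem_nhds hδ)
  have h2 : ∀ᶠ e in 𝓝[>] (0:ℝ), e < 1 := nhdsWithin_le_nhds (gt_mem_nhds one_pos)
  obtain ⟨e, ⟨he1, he2⟩, he0⟩ := ((h1.and h2).and self_mem_nhdsWithin).exists
  have he0 : 0 < e := he0
  have hbd : IsBoundedUnder (· ≤ ·) atTop (fun r : ℕ =>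
      f ((hgap θ r : ℝ) * e) / f (hgap θ r : ℝ)) := by
    refine isBoundedUnder_of ⟨1, fun r => ?_⟩
    have h0 : (0:ℝ) ≤ hgap θ r := Nat.cast_nonneg _
    exact div_le_one_of_le₀ (hmono _ _ (by positivity) (by nlinarith)) (hnn _ h0)
  have h3 := eventually_lt_of_limsup_lt he1 hbd
  have h4 := hst.eventually (gt_mem_nhds he0)
  have h5 : ∀ᶠ r in atTop, 1 ≤ hgap θ r := hθ.2.2.eventually (eventually_ge_atTop 1)
  filter_upwards [h3, h4, h5] with r h3 h4 h5
  have h6 : (0:ℝ) < hgap θ r := by exact_mod_cast h5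
  rw [div_lt_iff₀ h6] at h4
  have hc := hmono _ ((hgap θ r : ℝ) * e) (Nat.cast_nonneg _) (h4.le.trans_eq (mul_comm _ _))
  have hd := hnn _ h6.le
  rw [Real.dist_eq, sub_zero, abs_of_nonneg (div_nonneg (hnn _ (Nat.cast_nonneg _)) hd)]
  exact (div_le_div_of_nonneg_right hc hd).trans_lt h3
end

section
/- Let f be an unbounded modulus function and θ = (k_r) a lacunary sequence with h_r = k_r − k_{r−1} and I_r = (k_{r−1}, k_r]. Assume f is θ-compatible, i.e. lim_{ε→0⁺} limsup_{r→∞} f(h_r ε)/f(h_r) = 0. Then for any normed space X and any sequence (x_n) in X, if (x_n) is lacunary strong Cesàro convergent to L ∈ X, i.e. lim_{r→∞} (1/h_r) Σ_{k∈I_r} ‖x_k − L‖ = 0, then (x_n) is lacunary f-strong Cesàro convergent to L, i.e. lim_{r→∞} f(Σ_{k∈I_r} ‖x_k − L‖)/f(h_r) = 0. -/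
open Filter Topology
open scoped Classical BigOperators

/-- If `f` is `θ`-compatible, lacunary strong Cesàro convergence implies
lacunary `f`-strong Cesàro convergence. -/
theorem stmt3 {X : Type*} [NormedAddCommGroup X] [NormedSpace ℝ X]
    (f : ℝ → ℝ) (hf : IsUnboundedModulus f) (θ : ℕ → ℕ) (hθ : IsLacunary θ)
    (hcomp : ThetaCompatible f θ)
    (x : ℕ → X) (L : X) (h : LacStrongCesaro θ x L) :
    LacFStrongCesaro f θ x L := by
  obtain ⟨⟨hnn, hz, hsub, hmono, hcont⟩, hunb⟩ := hf
  have hgpos : ∀ᶠ r in atTop, (0 : ℝ) < (hgap θ r : ℝ) := by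
    filter_upwards [hθ.2.2.eventually_ge_atTop 1] with r hr
    have : 0 < hgap θ r := hr
    exact_mod_cast this
  unfold LacFStrongCesaro
  have hratio : ∀ r, 0 ≤ f (∑ k ∈ Ilac θ r, ‖x k - L‖) / f (hgap θ r : ℝ) := fun r =>
    div_nonneg (hnn _ (Finset.sum_nonneg fun _ _ => norm_nonneg _)) (hnn _ (Nat.cast_nonneg _))
  rw [tendsto_order]
  refine ⟨fun a ha => Eventually.of_forall fun r => ha.trans_le (hratio r), fun e he => ?_⟩
  have h1 : ∀ᶠ ε in 𝓝[>] (0 : ℝ), Filter.limsup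
      (fun r : ℕ => f ((hgap θ r : ℝ) * ε) / f (hgap θ r : ℝ)) atTop < e :=
    (tendsto_order.1 hcomp).2 e he
  have h2 : ∀ᶠ ε in 𝓝[>] (0 : ℝ), ε ∈ Set.Ioo (0 : ℝ) 1 := Ioo_mem_nhdsGT one_pos
  obtain ⟨ε, hlim, hε0, hε1⟩ := (h1.and h2).exists
  have hbdd : IsBoundedUnder (· ≤ ·) atTop
      (fun r : ℕ => f ((hgap θ r : ℝ) * ε) / f (hgap θ r : ℝ)) := by
    refine isBoundedUnder_of ⟨1, fun r => ?_⟩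
    have hg : (0 : ℝ) ≤ (hgap θ r : ℝ) := Nat.cast_nonneg _
    exact div_le_one_of_le₀ (hmono _ _ (by positivity) (mul_le_of_le_one_right hg hε1.le))
      (hnn _ hg)
  have h3 := eventually_lt_of_limsup_lt hlim hbdd
  have h4 := (tendsto_order.1 h).2 ε hε0
  filter_upwards [h3, h4, hgpos] with r h3 h4 hg
  refine lt_of_le_of_lt ?_ h3
  refine div_le_div_of_nonneg_right ?_ (hnn _ hg.le)
  refine hmono _ _ (Finset.sum_nonneg fun _ _ => norm_nonneg _) ?_
  rw [div_lt_iff₀ hg] at h4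
  linarith
end

section
/- Let f be an unbounded modulus function and θ = (k_r) a lacunary sequence with h_r = k_r − k_{r−1} and I_r = (k_{r−1}, k_r]. If f is not θ-compatible, then there exists a real sequence (x_n) which is lacunary statistically convergent to 0 but not lacunary f-statistically convergent to 0. Consequently, if every lacunary statistically convergent real sequence is lacunary f-statistically convergent (to the same limit), then f must be θ-compatible. -/
open Filter Topology
open scoped Classical BigOperators

theorem aux_freq (f : ℝ → ℝ) (hf : IsUnboundedModulus f) (θ : ℕ → ℕ)
    (h : ¬ ThetaCompatible f θ) : ∃ c : ℝ, 0 < c ∧ ∀ n : ℕ, ∃ᶠ r in atTop,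
      c < f ((hgap θ r : ℝ) * (1 / ((n : ℝ) + 1))) / f (hgap θ r : ℝ) := by
  obtain ⟨⟨h0, -, -, hm, -⟩, -⟩ := hf
  unfold ThetaCompatible at h
  rw [Metric.tendsto_nhds] at h
  push Not at h
  obtain ⟨c, hc, hfr⟩ := h
  refine ⟨c / 2, by positivity, fun n => ?_⟩
  have hn : (0 : ℝ) < 1 / ((n : ℝ) + 1) := by positivity
  obtain ⟨e, he, he0, hen⟩ := (hfr.and_eventually (Ioo_mem_nhdsGT hn)).exists
  by_contra hcon
  rw [not_frequently] at hcon
  have hnn : ∀ r, 0 ≤ f ((hgap θ r : ℝ) * e) / f (hgap θ r : ℝ) := fun r =>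
    div_nonneg (h0 _ (by positivity)) (h0 _ (by positivity))
  have hle : ∀ᶠ r in atTop, f ((hgap θ r : ℝ) * e) / f (hgap θ r : ℝ) ≤ c / 2 := by
    filter_upwards [hcon] with r hr
    refine le_trans ?_ (not_lt.mp hr)
    refine div_le_div_of_nonneg_right ?_ (h0 _ (by positivity))
    exact hm _ _ (by positivity) (mul_le_mul_of_nonneg_left hen.le (by positivity))
  have h1 := limsup_le_of_le (isCoboundedUnder_le_of_le atTop hnn) hle
  have h2 := le_limsup_of_frequently_le (Eventually.of_forall hnn).frequently
    (isBoundedUnder_of_eventually_le hle)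
  rw [Real.dist_eq, sub_zero, abs_of_nonneg h2] at he
  linarith

theorem aux_filter (θ : ℕ → ℕ) (hθ : StrictMono θ) (m : ℕ → ℕ) (hm : ∀ r, m r ≤ hgap θ r)
    (r k : ℕ) (hk : k ∈ Ilac θ r) :
    (∃ s, k ∈ Ilac θ s ∧ k ≤ θ (s - 1) + m s) ↔ k ≤ θ (r - 1) + m r := by
  constructor
  · rintro ⟨s, hs, h⟩
    have : s = r := by
      simp only [Ilac, Finset.mem_Ioc] at hk hs
      rcases lt_trichotomy s r with hlt | heq | hlt
      · have := hθ.monotone (show s ≤ r - 1 by omega)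
        omega
      · exact heq
      · have := hθ.monotone (show r ≤ s - 1 by omega)
        omega
    rwa [← this]
  · exact fun h => ⟨r, hk, h⟩

theorem aux_seq (θ : ℕ → ℕ) (hθ : StrictMono θ) (m : ℕ → ℕ) (hm : ∀ r, m r ≤ hgap θ r) :
    ∃ x : ℕ → ℝ, (∀ r, ∀ ε : ℝ, 0 < ε →
        ((Ilac θ r).filter fun k => ε < ‖x k - 0‖).card ≤ m r) ∧
      ∀ r, ((Ilac θ r).filter fun k => (1 / 2 : ℝ) < ‖x k - 0‖).card = m r := by
  let x : ℕ → ℝ := fun k => if ∃ s, k ∈ Ilac θ s ∧ k ≤ θ (s - 1) + m s then 1 else 0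
  have hcard : ∀ r, (Finset.Ioc (θ (r - 1)) (θ (r - 1) + m r)).card = m r := by
    intro r; simp
  refine ⟨x, fun r ε hε => ?_, fun r => ?_⟩
  · refine le_trans (Finset.card_le_card ?_) (hcard r).le
    intro k hk
    rw [Finset.mem_filter] at hk
    obtain ⟨hk, h⟩ := hk
    have := aux_filter θ hθ m hm r k hk
    by_cases hx : k ≤ θ (r - 1) + m r
    · simp only [Ilac, Finset.mem_Ioc] at hk ⊢
      exact ⟨hk.1, hx⟩
    · have : x k = 0 := if_neg (fun h => hx (this.mp h))
      rw [this] at h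
      simp at h
      linarith
  · refine Eq.trans (congrArg Finset.card ?_) (hcard r)
    ext k
    rw [Finset.mem_filter]
    constructor
    · rintro ⟨hk, h⟩
      have := aux_filter θ hθ m hm r k hk
      by_cases hx : k ≤ θ (r - 1) + m r
      · simp only [Ilac, Finset.mem_Ioc] at hk ⊢
        exact ⟨hk.1, hx⟩
      · have : x k = 0 := if_neg (fun h => hx (this.mp h))
        rw [this] at h
        norm_num at h
    · intro h
      rw [Finset.mem_Ioc] at h
      have hk : k ∈ Ilac θ r := by
        have h1 := hm r
        have h2 := hθ.monotone (show r - 1 ≤ r by omega)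
        simp only [Ilac, Finset.mem_Ioc]
        unfold hgap at h1
        omega
      refine ⟨hk, ?_⟩
      have : x k = 1 := if_pos ((aux_filter θ hθ m hm r k hk).mpr h.2)
      rw [this]
      norm_num

theorem aux_main (f : ℝ → ℝ) (hf : IsUnboundedModulus f) (θ : ℕ → ℕ) (hθ : IsLacunary θ)
    (h : ¬ ThetaCompatible f θ) :
    ∃ x : ℕ → ℝ, LacStatConv θ x 0 ∧ ¬ LacFStatConv f θ x 0 := by
  obtain ⟨c, hc, hfr⟩ := aux_freq f hf θ h
  obtain ⟨⟨h0, -, -, hmono, -⟩, -⟩ := hf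
  obtain ⟨-, hθm, hθt⟩ := hθ
  obtain ⟨φ, hφ, hφc⟩ := extraction_forall_of_frequently hfr
  let δ : ℕ → ℝ := Function.extend φ (fun n : ℕ => 1 / ((n : ℝ) + 1)) 0
  have hδφ : ∀ n, δ (φ n) = 1 / ((n : ℝ) + 1) := fun n => hφ.injective.extend_apply _ _ n
  have hδo : ∀ r, (¬ ∃ n, φ n = r) → δ r = 0 := fun r hr =>
    Function.extend_apply' _ _ r hr
  have hδ0 : ∀ r, 0 ≤ δ r := by
    intro r
    by_cases hr : ∃ n, φ n = r
    · obtain ⟨n, rfl⟩ := hr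
      rw [hδφ]; positivity
    · rw [hδo r hr]
  have hδ1 : ∀ r, δ r ≤ 1 := by
    intro r
    by_cases hr : ∃ n, φ n = r
    · obtain ⟨n, rfl⟩ := hr
      rw [hδφ, div_le_one (by positivity)]
      linarith [(Nat.cast_nonneg n : (0 : ℝ) ≤ n)]
    · rw [hδo r hr]; exact zero_le_one
  have hδt : Tendsto δ atTop (𝓝 0) := by
    rw [Metric.tendsto_atTop]
    intro e he
    obtain ⟨N, hN⟩ := exists_nat_one_div_lt he
    refine ⟨φ N, fun r hr => ?_⟩
    rw [Real.dist_eq, sub_zero, abs_of_nonneg (hδ0 r)]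
    by_cases hr' : ∃ n, φ n = r
    · obtain ⟨n, rfl⟩ := hr'
      rw [hδφ]
      have : N ≤ n := hφ.le_iff_le.mp hr
      exact lt_of_le_of_lt (Nat.one_div_le_one_div this) hN
    · rw [hδo r hr']; exact he
  let m : ℕ → ℕ := fun r => ⌈(hgap θ r : ℝ) * δ r⌉₊
  have hm : ∀ r, m r ≤ hgap θ r := fun r => Nat.ceil_le.mpr
    (mul_le_of_le_one_right (Nat.cast_nonneg _) (hδ1 r))
  have hgt : Tendsto (fun r => hgap θ r) atTop atTop := hθt
  have hgtR : Tendsto (fun r => (hgap θ r : ℝ)) atTop atTop :=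
    tendsto_natCast_atTop_atTop.comp hgt
  obtain ⟨x, hx1, hx2⟩ := aux_seq θ hθm m hm
  refine ⟨x, fun ε hε => ?_, fun hcon => ?_⟩
  · have hlim : Tendsto (fun r => δ r + (hgap θ r : ℝ)⁻¹) atTop (𝓝 0) := by
      simpa using hδt.add (tendsto_inv_atTop_zero.comp hgtR)
    refine squeeze_zero' (Eventually.of_forall fun r => by positivity) ?_ hlim
    filter_upwards [hgtR.eventually_gt_atTop 0] with r hr
    rw [div_le_iff₀ hr, add_mul, inv_mul_cancel₀ hr.ne']
    have h1 : ((((Ilac θ r).filter fun k => ε < ‖x k - 0‖).card : ℝ)) ≤ (m r : ℝ) := by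
      exact_mod_cast hx1 r ε hε
    have h2 : (m r : ℝ) < (hgap θ r : ℝ) * δ r + 1 :=
      Nat.ceil_lt_add_one (mul_nonneg hr.le (hδ0 r))
    linarith
  · have h1 := (hcon (1 / 2) (by norm_num)).comp hφ.tendsto_atTop
    obtain ⟨n, hn⟩ := (h1.eventually_lt_const hc).exists
    simp only [Function.comp, hx2] at hn
    have h2 := hφc n
    have h3 : f ((hgap θ (φ n) : ℝ) * (1 / ((n : ℝ) + 1))) ≤ f (m (φ n) : ℝ) := by
      refine hmono _ _ (by positivity) ?_
      rw [← hδφ n]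
      exact Nat.le_ceil _
    have h4 := div_le_div_of_nonneg_right h3 (h0 (hgap θ (φ n) : ℝ) (by positivity))
    linarith

/-- If `f` is not `θ`-compatible, there is a real sequence which is lacunary statistically
convergent to `0` but not lacunary `f`-statistically convergent to `0`; consequently, if
lacunary statistical convergence always implies lacunary `f`-statistical convergence, then
`f` must be `θ`-compatible. -/
theorem stmt4 (f : ℝ → ℝ) (hf : IsUnboundedModulus f) (θ : ℕ → ℕ) (hθ : IsLacunary θ) :
    (¬ ThetaCompatible f θ →
      ∃ x : ℕ → ℝ, LacStatConv θ x 0 ∧ ¬ LacFStatConv f θ x 0) ∧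
    ((∀ (x : ℕ → ℝ) (L : ℝ), LacStatConv θ x L → LacFStatConv f θ x L) →
      ThetaCompatible f θ) := by
  refine ⟨aux_main f hf θ hθ, fun h => ?_⟩
  by_contra hc
  obtain ⟨x, h1, h2⟩ := aux_main f hf θ hθ hc
  exact h2 (h x 0 h1)
end

section
/- Let f be an unbounded modulus function and θ = (k_r) a lacunary sequence with h_r = k_r − k_{r−1} and I_r = (k_{r−1}, k_r]. If f is not θ-compatible, then there exists a real sequence (x_n) which is lacunary strong Cesàro convergent to 0 (lim_{r→∞} (1/h_r) Σ_{k∈I_r} |x_k| = 0) but not lacunary f-strong Cesàro convergent to 0 (it is not the case that lim_{r→∞} f(Σ_{k∈I_r} |x_k|)/f(h_r) = 0). Consequently, if every lacunary strong Cesàro convergent real sequence is lacunary f-strong Cesàro convergent (to the same limit), then f must be θ-compatible. -/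
open Filter Topology
open scoped Classical BigOperators

theorem aux_first (f : ℝ → ℝ) (hf : IsUnboundedModulus f) (θ : ℕ → ℕ) (hθ : IsLacunary θ)
    (hn : ¬ ThetaCompatible f θ) :
    ∃ x : ℕ → ℝ, LacStrongCesaro θ x 0 ∧ ¬ LacFStrongCesaro f θ x 0 := by
  obtain ⟨⟨hnn, hz, -, hmono, -⟩, -⟩ := hf
  obtain ⟨-, hsm, htop⟩ := hθ
  have hratio0 : ∀ ε : ℝ, 0 < ε → ∀ r, 0 ≤ f ((hgap θ r : ℝ) * ε) / f (hgap θ r : ℝ) := by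
    intro ε hε r
    exact div_nonneg (hnn _ (by positivity)) (hnn _ (by positivity))
  have hratio1 : ∀ ε : ℝ, 0 < ε → ε ≤ 1 → ∀ r,
      f ((hgap θ r : ℝ) * ε) / f (hgap θ r : ℝ) ≤ 1 := by
    intro ε hε hε1 r
    refine div_le_one_of_le₀ (hmono _ _ (by positivity) ?_) (hnn _ (by positivity))
    exact mul_le_of_le_one_right (by positivity) hε1
  -- a positive constant violating compatibility
  have key : ∃ c : ℝ, 0 < c ∧ ∀ δ : ℝ, 0 < δ → ∃ ε : ℝ, 0 < ε ∧ ε < δ ∧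
      ∃ᶠ r in atTop, c < f ((hgap θ r : ℝ) * ε) / f (hgap θ r : ℝ) := by
    by_contra hcon
    push Not at hcon
    apply hn
    unfold ThetaCompatible
    rw [Metric.tendsto_nhdsWithin_nhds]
    intro c hc
    obtain ⟨δ, hδ, H⟩ := hcon (c / 2) (by positivity)
    refine ⟨min δ 1, by positivity, ?_⟩
    intro ε hε hd
    have hε0 : 0 < ε := hε
    rw [Real.dist_eq, sub_zero, abs_of_pos hε0] at hd
    have h1 : ε < δ := lt_of_lt_of_le hd (min_le_left _ _)
    have h2 : ε ≤ 1 := (lt_of_lt_of_le hd (min_le_right _ _)).le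
    have h3 := H ε hε0 h1
    have hbdd : IsBoundedUnder (· ≤ ·) atTop
        (fun r : ℕ => f ((hgap θ r : ℝ) * ε) / f (hgap θ r : ℝ)) :=
      isBoundedUnder_of ⟨1, hratio1 ε hε0 h2⟩
    have hbdd' : IsBoundedUnder (· ≥ ·) atTop
        (fun r : ℕ => f ((hgap θ r : ℝ) * ε) / f (hgap θ r : ℝ)) :=
      isBoundedUnder_of ⟨0, hratio0 ε hε0⟩
    have hle : Filter.limsup (fun r : ℕ => f ((hgap θ r : ℝ) * ε) / f (hgap θ r : ℝ)) atTop
        ≤ c / 2 := by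
      apply limsup_le_of_le hbdd'.isCoboundedUnder_le
      filter_upwards [h3] with r hr
      simpa using hr
    have hge : 0 ≤ Filter.limsup
        (fun r : ℕ => f ((hgap θ r : ℝ) * ε) / f (hgap θ r : ℝ)) atTop := by
      apply le_limsup_of_frequently_le _ hbdd
      exact (Eventually.of_forall (hratio0 ε hε0)).frequently
    rw [Real.dist_eq, sub_zero, abs_of_nonneg hge]
    linarith
  obtain ⟨c, hc, key⟩ := key
  choose ε hε0 hε1 hfr using fun n : ℕ => key (1 / ((n : ℝ) + 1)) (by positivity)
  obtain ⟨φ, hφ, hP⟩ := extraction_forall_of_frequently hfr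
  have hεlim : Tendsto ε atTop (𝓝 0) :=
    squeeze_zero (fun n => (hε0 n).le) (fun n => (hε1 n).le) tendsto_one_div_add_atTop_nhds_zero_nat
  let e : ℕ → ℝ := Function.extend φ ε 0
  have heφ : ∀ n, e (φ n) = ε n := fun n => hφ.injective.extend_apply _ _ _
  have he' : ∀ r, (¬ ∃ n, φ n = r) → e r = 0 := fun r h => Function.extend_apply' _ _ _ h
  have he0 : ∀ r, 0 ≤ e r := by
    intro r
    by_cases h : ∃ n, φ n = r
    · obtain ⟨n, rfl⟩ := h
      rw [heφ]; exact (hε0 n).le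
    · rw [he' r h]
  have helim : Tendsto e atTop (𝓝 0) := by
    rw [Metric.tendsto_atTop] at hεlim ⊢
    intro d hd
    obtain ⟨N, hN⟩ := hεlim d hd
    refine ⟨φ N, fun r hr => ?_⟩
    by_cases h : ∃ n, φ n = r
    · obtain ⟨n, rfl⟩ := h
      rw [heφ]; exact hN n (hφ.le_iff_le.mp hr)
    · rw [he' r h]; simpa using hd
  have hex : ∀ k, ∃ r, k ≤ θ r := fun k => ⟨k, hsm.id_le k⟩
  let x : ℕ → ℝ := fun k => e (Nat.find (hex k))
  have hx : ∀ r, ∀ k ∈ Ilac θ r, x k = e r := by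
    intro r k hk
    rw [Ilac, Finset.mem_Ioc] at hk
    have : Nat.find (hex k) = r := by
      rw [Nat.find_eq_iff]
      refine ⟨hk.2, fun s hs h => ?_⟩
      have := hsm.monotone (show s ≤ r - 1 by omega)
      omega
    simp only [x, this]
  have hsum : ∀ r, ∑ k ∈ Ilac θ r, ‖x k - 0‖ = (hgap θ r : ℝ) * e r := by
    intro r
    rw [Finset.sum_congr rfl (g := fun _ => e r)]
    · simp [Ilac, hgap]
    · intro k hk
      rw [hx r k hk, sub_zero, Real.norm_of_nonneg (he0 r)]
  refine ⟨x, ?_, ?_⟩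
  · unfold LacStrongCesaro
    simp only [hsum]
    apply squeeze_zero (fun r => ?_) (fun r => ?_) helim
    · exact div_nonneg (mul_nonneg (by positivity) (he0 r)) (by positivity)
    · apply div_le_of_le_mul₀ (by positivity) (he0 r)
      rw [mul_comm]
  · unfold LacFStrongCesaro
    simp only [hsum]
    intro ht
    have h2 := ht.comp hφ.tendsto_atTop
    have h3 := ge_of_tendsto' (b := c) h2 (fun n => by
      have := hP n
      simp only [Function.comp, heφ]
      exact this.le)
    linarith

/-- If `f` is not `θ`-compatible, there is a real sequence which is lacunary strong Cesàro
convergent to `0` but not lacunary `f`-strong Cesàro convergent to `0`; consequently, if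
lacunary strong Cesàro convergence always implies lacunary `f`-strong Cesàro convergence,
then `f` must be `θ`-compatible. -/
theorem stmt5 (f : ℝ → ℝ) (hf : IsUnboundedModulus f) (θ : ℕ → ℕ) (hθ : IsLacunary θ) :
    (¬ ThetaCompatible f θ →
      ∃ x : ℕ → ℝ, LacStrongCesaro θ x 0 ∧ ¬ LacFStrongCesaro f θ x 0) ∧
    ((∀ (x : ℕ → ℝ) (L : ℝ), LacStrongCesaro θ x L → LacFStrongCesaro f θ x L) →
      ThetaCompatible f θ) := by
  refine ⟨aux_first f hf θ hθ, fun h => ?_⟩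
  by_contra hn
  obtain ⟨x, hx, hx'⟩ := aux_first f hf θ hθ hn
  exact hx' (h x 0 hx)
end

section
/- Let f be an unbounded modulus function, θ = (k_r) a lacunary sequence with h_r = k_r − k_{r−1} and I_r = (k_{r−1}, k_r], X a normed space and (x_n) a sequence in X. If (x_n) is lacunary f-strong Cesàro convergent to L ∈ X, i.e. lim_{r→∞} f(Σ_{k∈I_r} ‖x_k − L‖)/f(h_r) = 0, then (x_n) is lacunary f-statistically convergent to L, i.e. for every ε > 0, lim_{r→∞} f(#{k ∈ I_r : ‖x_k − L‖ > ε})/f(h_r) = 0. -/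
open Filter Topology
open scoped Classical BigOperators

/-- Lacunary `f`-strong Cesàro convergence implies lacunary `f`-statistical convergence. -/
theorem stmt6 {X : Type*} [NormedAddCommGroup X] [NormedSpace ℝ X]
    (f : ℝ → ℝ) (hf : IsUnboundedModulus f) (θ : ℕ → ℕ) (hθ : IsLacunary θ)
    (x : ℕ → X) (L : X) (h : LacFStrongCesaro f θ x L) :
    LacFStatConv f θ x L := by
  intro ε hε
  obtain ⟨⟨hnn, h0, hsub, hmono, -⟩, -⟩ := hf
  obtain ⟨n, hn⟩ := exists_nat_ge (1 / ε)
  have hmul : ∀ (m : ℕ) (y : ℝ), 0 ≤ y → f ((m : ℝ) * y) ≤ (m : ℝ) * f y := by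
    intro m y hy
    induction m with
    | zero => simp [(h0 0 le_rfl).2 rfl]
    | succ m ih =>
      have h1 := hsub ((m : ℝ) * y) y (by positivity) hy
      push_cast
      rw [add_mul, add_mul, one_mul, one_mul]
      linarith
  have hlim := Tendsto.const_mul (n : ℝ) h
  rw [mul_zero] at hlim
  refine squeeze_zero (fun r => ?_) (fun r => ?_) hlim
  · exact div_nonneg (hnn _ (Nat.cast_nonneg _)) (hnn _ (Nat.cast_nonneg _))
  · rw [← mul_div_assoc]
    refine div_le_div_of_nonneg_right ?_ (hnn _ (Nat.cast_nonneg _))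
    have hS : 0 ≤ ∑ k ∈ Ilac θ r, ‖x k - L‖ := Finset.sum_nonneg fun _ _ => norm_nonneg _
    refine le_trans (hmono _ _ (Nat.cast_nonneg _) ?_) (hmul n _ hS)
    have h1 : (((Ilac θ r).filter fun k => ε < ‖x k - L‖).card : ℝ) * ε
        ≤ ∑ k ∈ Ilac θ r, ‖x k - L‖ := by
      rw [← nsmul_eq_mul]
      refine le_trans (Finset.card_nsmul_le_sum _ (fun k => ‖x k - L‖) ε ?_)
        (Finset.sum_le_sum_of_subset_of_nonneg (Finset.filter_subset _ _)
          fun _ _ _ => norm_nonneg _)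
      intro k hk
      exact (Finset.mem_filter.1 hk).2.le
    calc (((Ilac θ r).filter fun k => ε < ‖x k - L‖).card : ℝ)
        ≤ (∑ k ∈ Ilac θ r, ‖x k - L‖) / ε := (le_div_iff₀ hε).2 h1
      _ = 1 / ε * ∑ k ∈ Ilac θ r, ‖x k - L‖ := by ring
      _ ≤ n * ∑ k ∈ Ilac θ r, ‖x k - L‖ := mul_le_mul_of_nonneg_right hn hS
end

section
/- Let f be an unbounded modulus function and θ = (k_r) a lacunary sequence with h_r = k_r − k_{r−1} and I_r = (k_{r−1}, k_r]. Assume f is θ-compatible, i.e. lim_{ε→0⁺} limsup_{r→∞} f(h_r ε)/f(h_r) = 0. Let X be a normed space and (x_n) a sequence in X which is lacunary f-statistically convergent to L ∈ X and lacunary uniformly integrable, i.e. lim_{M→∞} sup_r Σ_{k∈I_r, ‖x_k‖≥M} ‖x_k‖/h_r = 0 in the sense that lim_{M→∞} sup_r (1/h_r) Σ_{k∈I_r, ‖x_k‖≥M} ‖x_k‖ = 0. Then (x_n) is lacunary f-strong Cesàro convergent to L, i.e. lim_{r→∞} f(Σ_{k∈I_r} ‖x_k − L‖)/f(h_r) =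 0. -/
open Filter Topology
open scoped Classical BigOperators

/-- If `f` is `θ`-compatible, then every lacunary uniformly integrable sequence which is
lacunary `f`-statistically convergent to `L` is lacunary `f`-strong Cesàro convergent
to `L`. -/
theorem stmt8 {X : Type*} [NormedAddCommGroup X] [NormedSpace ℝ X]
    (f : ℝ → ℝ) (hf : IsUnboundedModulus f) (θ : ℕ → ℕ) (hθ : IsLacunary θ)
    (hcomp : ThetaCompatible f θ)
    (x : ℕ → X) (L : X) (hstat : LacFStatConv f θ x L) (hui : LacUnifInt θ x) :
    LacFStrongCesaro f θ x L := by
  obtain ⟨⟨hnn, hz, hsub, hmono, -⟩, -⟩ := hf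
  obtain ⟨-, -, hgt⟩ := hθ
  have hmul : ∀ (N : ℕ) (c : ℝ), 0 ≤ c → f (N * c) ≤ N * f c := by
    intro N c hc
    induction N with
    | zero => simp [(hz 0 le_rfl).2 rfl]
    | succ n ih =>
      have h1 := hsub (n * c) c (by positivity) hc
      push_cast
      rw [add_mul, add_mul, one_mul, one_mul]
      linarith
  have hpos : ∀ᶠ r in atTop, 0 < hgap θ r := hgt.eventually_gt_atTop 0
  unfold LacFStrongCesaro
  rw [Metric.tendsto_nhds]
  intro η hη
  -- choose δ
  have h1 : ∀ᶠ ε : ℝ in 𝓝[>] (0 : ℝ),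
      Filter.limsup (fun r : ℕ => f ((hgap θ r : ℝ) * ε) / f (hgap θ r : ℝ)) atTop < η / 6 :=
    hcomp.eventually_lt_const (by positivity)
  have h2 : ∀ᶠ ε : ℝ in 𝓝[>] (0 : ℝ), ε ∈ Set.Ioo (0 : ℝ) 1 :=
    Ioo_mem_nhdsGT one_pos
  obtain ⟨δ, hδl, hδ0, hδ1⟩ := (h1.and h2).exists
  have hev1 : ∀ᶠ r in atTop, f ((hgap θ r : ℝ) * δ) / f (hgap θ r : ℝ) < η / 6 := by
    refine Filter.eventually_lt_of_limsup_lt hδl ?_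
    refine Filter.isBoundedUnder_of ⟨1, fun r => ?_⟩
    refine div_le_one_of_le₀ (hmono _ _ (by positivity) ?_) (hnn _ (by positivity))
    exact mul_le_of_le_one_right (by positivity) hδ1.le
  -- choose M
  have h3 := hui.eventually_lt_const (ENNReal.ofReal_pos.2 hδ0)
  obtain ⟨M, hM, hML⟩ := (h3.and (eventually_ge_atTop ‖L‖)).exists
  have htail : ∀ r, 0 < hgap θ r →
      (∑ k ∈ (Ilac θ r).filter fun k => M ≤ ‖x k‖, ‖x k‖) ≤ δ * (hgap θ r : ℝ) := by
    intro r hr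
    have h4 := (le_iSup (fun r : ℕ => ENNReal.ofReal
        ((∑ k ∈ (Ilac θ r).filter fun k => M ≤ ‖x k‖, ‖x k‖) / (hgap θ r : ℝ))) r).trans_lt hM
    have h5 := (ENNReal.ofReal_lt_ofReal_iff hδ0).1 h4
    have h6 : (0 : ℝ) < hgap θ r := by exact_mod_cast hr
    exact ((div_lt_iff₀ h6).1 h5).le
  obtain ⟨N, hN⟩ := exists_nat_ge (2 * M)
  have hev2 : ∀ᶠ r in atTop,
      f ((((Ilac θ r).filter fun k => δ < ‖x k - L‖).card : ℝ)) / f (hgap θ r : ℝ)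
        < η / (3 * (N + 1)) :=
    (hstat δ hδ0).eventually_lt_const (by positivity)
  filter_upwards [hpos, hev1, hev2] with r hr ha hb
  set c : ℝ := (((Ilac θ r).filter fun k => δ < ‖x k - L‖).card : ℝ) with hc
  set h : ℝ := (hgap θ r : ℝ) with hh
  have hc0 : 0 ≤ c := by positivity
  have hh0 : 0 < h := by rw [hh]; exact_mod_cast hr
  have hcard : ((Ilac θ r).card : ℝ) = h := by
    rw [hh]; simp [Ilac, hgap]
  have hsum : ∑ k ∈ Ilac θ r, ‖x k - L‖ ≤ (3 : ℕ) * (h * δ) + N * c := by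
    have hpt : ∀ k ∈ Ilac θ r, ‖x k - L‖ ≤ δ + (N * (if δ < ‖x k - L‖ then (1 : ℝ) else 0)
        + 2 * (if M ≤ ‖x k‖ then ‖x k‖ else 0)) := by
      intro k _
      have ht := norm_sub_le (x k) L
      have hx := norm_nonneg (x k)
      have hN0 : (0 : ℝ) ≤ N := by positivity
      split_ifs <;> linarith
    refine (Finset.sum_le_sum hpt).trans ?_
    rw [Finset.sum_add_distrib, Finset.sum_add_distrib, ← Finset.mul_sum, ← Finset.mul_sum,
      ← Finset.sum_filter, ← Finset.sum_filter, Finset.sum_const, Finset.sum_const,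
      nsmul_eq_mul, nsmul_eq_mul, hcard, mul_one, ← hc]
    have := htail r hr
    push_cast
    linarith
  have hS0 : 0 ≤ ∑ k ∈ Ilac θ r, ‖x k - L‖ := Finset.sum_nonneg fun _ _ => norm_nonneg _
  have hfh : 0 < f h := lt_of_le_of_ne (hnn _ hh0.le) fun e => hh0.ne' ((hz _ hh0.le).1 e.symm)
  have hfS : f (∑ k ∈ Ilac θ r, ‖x k - L‖) ≤ 3 * f (h * δ) + N * f c := by
    refine (hmono _ _ hS0 hsum).trans ((hsub _ _ (by positivity) (by positivity)).trans ?_)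
    have := hmul 3 (h * δ) (by positivity)
    have := hmul N c hc0
    push_cast at *
    linarith
  rw [Real.dist_eq, sub_zero, abs_of_nonneg (div_nonneg (hnn _ hS0) hfh.le), div_lt_iff₀ hfh]
  rw [div_lt_iff₀ hfh] at ha hb
  have hfc := hnn c hc0
  have hb' : (N : ℝ) * f c ≤ η / 3 * f h := by
    calc (N : ℝ) * f c ≤ (N + 1) * f c := by linarith
      _ ≤ (N + 1) * (η / (3 * (N + 1)) * f h) := by gcongr
      _ = η / 3 * f h := by field_simp
  have : 0 < η * f h := by positivity
  linarith
end

section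
/- Let f be an unbounded modulus function and θ = (k_r) a lacunary sequence with h_r = k_r − k_{r−1}, I_r = (k_{r−1}, k_r] and ratios q_r = k_r/k_{r−1}. If liminf_r q_r > 1, then for any normed space X and any sequence (x_n) in X which is f-strong Cesàro convergent to L ∈ X, i.e. lim_{n→∞} f(Σ_{k=1}^{n} ‖x_k − L‖)/f(n) = 0, the sequence (x_n) is lacunary f-strong Cesàro convergent to L, i.e. lim_{r→∞} f(Σ_{k∈I_r} ‖x_k − L‖)/f(h_r) = 0. -/
open Filter Topology
open scoped Classical BigOperators

/-- If `liminf_r q_r > 1`, then `f`-strong Cesàro convergence implies lacunary `f`-strong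
Cesàro convergence. -/
theorem stmt11 {X : Type*} [NormedAddCommGroup X] [NormedSpace ℝ X]
    (f : ℝ → ℝ) (hf : IsUnboundedModulus f) (θ : ℕ → ℕ) (hθ : IsLacunary θ)
    (hq : 1 < Filter.liminf (qratio θ) atTop)
    (x : ℕ → X) (L : X) (h : FStrongCesaro f x L) :
    LacFStrongCesaro f θ x L := by
  obtain ⟨⟨hnn, hz, hsub, hmono, -⟩, -⟩ := hf
  obtain ⟨h0, hsm, -⟩ := hθ
  have hmul : ∀ (n : ℕ) (y : ℝ), 0 ≤ y → f (n * y) ≤ n * f y := by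
    intro n y hy
    induction n with
    | zero => simp [(hz 0 le_rfl).2 rfl]
    | succ n ih =>
      have h1 := hsub (n * y) y (by positivity) hy
      have e : ((n + 1 : ℕ) : ℝ) * y = n * y + y := by push_cast; ring
      rw [e]
      push_cast
      linarith
  obtain ⟨c, hc1, hc2⟩ := ENNReal.lt_iff_exists_nnreal_btwn.1 hq
  have hc : (1 : ℝ) < c := by exact_mod_cast hc1
  have hev : ∀ᶠ r in atTop, (c : ENNReal) < qratio θ r :=
    eventually_lt_of_lt_liminf hc2
  obtain ⟨N, hN⟩ := exists_nat_ge ((c : ℝ) / (c - 1))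
  have hN' : (c : ℝ) ≤ N * (c - 1) := by
    rwa [div_le_iff₀ (by linarith)] at hN
  have hlim : Tendsto (fun r : ℕ => (N : ℝ) *
      (f (∑ k ∈ Finset.Icc 1 (θ r), ‖x k - L‖) / f (θ r : ℝ))) atTop (𝓝 0) := by
    have := (Tendsto.comp h hsm.tendsto_atTop).const_mul (N : ℝ)
    simpa using this
  unfold LacFStrongCesaro
  refine squeeze_zero' ?_ ?_ hlim
  · filter_upwards with r
    exact div_nonneg (hnn _ (Finset.sum_nonneg fun _ _ => norm_nonneg _)) (hnn _ (by positivity))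
  · filter_upwards [hev, eventually_ge_atTop 1] with r hr hr1
    have hlt : θ (r - 1) < θ r := hsm (by omega)
    have hg : ((hgap θ r : ℕ) : ℝ) = (θ r : ℝ) - θ (r - 1) := by
      unfold hgap
      rw [Nat.cast_sub hlt.le]
    have hltR : (θ (r - 1) : ℝ) < θ r := by exact_mod_cast hlt
    have hcb : (c : ℝ) * θ (r - 1) ≤ θ r := by
      have h1 : (c : ENNReal) * (θ (r - 1) : ENNReal) ≤ (θ r : ENNReal) :=
        ENNReal.mul_le_of_le_div hr.le
      exact_mod_cast h1
    have hpos : (0 : ℝ) < hgap θ r := by rw [hg]; linarith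
    have hθpos : (0 : ℝ) < θ r := lt_of_le_of_lt (by positivity) hltR
    have hfp : ∀ y : ℝ, 0 < y → 0 < f y := fun y hy =>
      lt_of_le_of_ne (hnn y hy.le) fun e => hy.ne' ((hz y hy.le).1 e.symm)
    have hle : (θ r : ℝ) ≤ N * (hgap θ r : ℝ) := by
      have h1 := mul_le_mul_of_nonneg_right hN' hpos.le
      refine le_of_mul_le_mul_left (a := (c : ℝ) - 1) ?_ (by linarith)
      rw [hg] at h1 ⊢
      nlinarith
    have hfle : f (θ r) ≤ N * f (hgap θ r) :=
      (hmono _ _ hθpos.le hle).trans (hmul N _ hpos.le)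
    have hS : f (∑ k ∈ Ilac θ r, ‖x k - L‖) ≤ f (∑ k ∈ Finset.Icc 1 (θ r), ‖x k - L‖) := by
      refine hmono _ _ (Finset.sum_nonneg fun _ _ => norm_nonneg _) ?_
      refine Finset.sum_le_sum_of_subset_of_nonneg ?_ fun _ _ _ => norm_nonneg _
      intro k hk
      simp only [Ilac, Finset.mem_Ioc, Finset.mem_Icc] at hk ⊢
      omega
    have hS0 : 0 ≤ f (∑ k ∈ Finset.Icc 1 (θ r), ‖x k - L‖) :=
      hnn _ (Finset.sum_nonneg fun _ _ => norm_nonneg _)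
    have p1 := hfp _ hpos
    have p2 := hfp _ hθpos
    rw [← mul_div_assoc, div_le_div_iff₀ p1 p2]
    calc _ ≤ f (∑ k ∈ Finset.Icc 1 (θ r), ‖x k - L‖) * (N * f (hgap θ r)) :=
          mul_le_mul hS hfle p2.le hS0
      _ = _ := by ring
end

section
/- Let f be an unbounded modulus function which is compatible, i.e. lim_{ε→0⁺} limsup_{n→∞} f(nε)/f(n) = 0, and let θ = (k_r) be a lacunary sequence with h_r = k_r − k_{r−1}, I_r = (k_{r−1}, k_r] and ratios q_r = k_r/k_{r−1}. If liminf_r q_r = 1, then there exists a real sequence (x_n) which is f-strong Cesàro convergent to 0 but not lacunary f-strong Cesàro convergent to 0. Consequently, if every f-strong Cesàro convergent real sequence is lacunary f-strong Cesàro convergent (to the same limit), then liminf_r q_r > 1. -/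
open Filter Topology
open scoped Classical BigOperators

lemma aux_exists (θ : ℕ → ℕ) (hθ : IsLacunary θ) (hl : Filter.liminf (qratio θ) atTop = 1)
    (c N : ℕ) (hc : 0 < c) :
    ∃ r, N < r ∧ c * hgap θ r ≤ θ (r - 1) ∧ c * N ≤ θ (r - 1) := by
  obtain ⟨h0, hm, -⟩ := hθ
  have hlt : Filter.liminf (qratio θ) atTop < 1 + (c : ENNReal)⁻¹ := by
    rw [hl]
    exact ENNReal.lt_add_right (by simp) (by simp)
  have hfr := frequently_lt_of_liminf_lt (by isBoundedDefault) hlt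
  obtain ⟨r, hr, hrN⟩ := (hfr.and_eventually (eventually_ge_atTop (c * N + N + 2))).exists
  have hid : r - 1 ≤ θ (r - 1) := hm.id_le _
  have hpos : 0 < θ (r - 1) := by omega
  refine ⟨r, by omega, ?_, by omega⟩
  unfold qratio at hr
  rw [ENNReal.div_lt_iff (Or.inl (by exact_mod_cast hpos.ne')) (Or.inl (by simp))] at hr
  have h1 : (c : ENNReal) * θ r ≤ (c : ENNReal) * ((1 + (c : ENNReal)⁻¹) * θ (r - 1)) := by
    gcongr
  have hcc : (c : ENNReal) * (c : ENNReal)⁻¹ = 1 :=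
    ENNReal.mul_inv_cancel (by exact_mod_cast hc.ne') (by simp)
  rw [← mul_assoc, mul_add, hcc, mul_one] at h1
  have h2 : c * θ r ≤ (c + 1) * θ (r - 1) := by exact_mod_cast h1
  unfold hgap
  rw [Nat.mul_sub]
  have : (c + 1) * θ (r - 1) = c * θ (r - 1) + θ (r - 1) := by ring
  omega

lemma aux_seq_s12 (θ : ℕ → ℕ) (hθ : IsLacunary θ) (hl : Filter.liminf (qratio θ) atTop = 1) :
    ∃ R : ℕ → ℕ, ∀ j, θ (R j) < R (j + 1) ∧
      (j + 1) * hgap θ (R (j + 1)) ≤ θ (R (j + 1) - 1) ∧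
      (j + 1) * θ (R j) ≤ θ (R (j + 1) - 1) := by
  choose g hg using fun j N => aux_exists θ hθ hl (j + 1) N (Nat.succ_pos j)
  exact ⟨fun n => Nat.rec 0 (fun j p => g j (θ p)) n, fun j => hg j _⟩

lemma aux_set (θ : ℕ → ℕ) (hθ : IsLacunary θ) (hl : Filter.liminf (qratio θ) atTop = 1) :
    ∃ A : Set ℕ, (∀ J : ℕ, ∀ᶠ n : ℕ in atTop,
        (J + 1) * ((Finset.Icc 1 n).filter (· ∈ A)).card ≤ 2 * n) ∧
      ∃ᶠ r in atTop, ∀ k ∈ Ilac θ r, k ∈ A := by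
  obtain ⟨R, hR⟩ := aux_seq_s12 θ hθ hl
  obtain ⟨h0, hm, -⟩ := hθ
  have hid : ∀ n, n ≤ θ n := fun n => hm.id_le n
  have hRm : StrictMono R := strictMono_nat_of_lt_succ fun j => (hid _).trans_lt (hR j).1
  have hRid : ∀ n, n ≤ R n := fun n => hRm.id_le n
  refine ⟨{k | ∃ j, k ∈ Ilac θ (R j)}, fun J => ?_, ?_⟩
  · filter_upwards [eventually_gt_atTop (θ (R (J + 1) - 1))] with n hn
    have hex : ∃ m, n ≤ θ (R m - 1) := ⟨n + 1, by
      have := hRid (n + 1)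
      have := hid (R (n + 1) - 1)
      omega⟩
    obtain ⟨m, hm1, hm2⟩ : ∃ m, n ≤ θ (R m - 1) ∧ ∀ i < m, θ (R i - 1) < n :=
      ⟨Nat.find hex, Nat.find_spec hex, fun i hi => not_le.mp (Nat.find_min hex hi)⟩
    have hmJ : J + 1 < m := by
      by_contra hcon
      have : θ (R m - 1) ≤ θ (R (J + 1) - 1) :=
        hm.monotone (Nat.sub_le_sub_right (hRm.monotone (not_lt.mp hcon)) 1)
      omega
    obtain ⟨j, rfl⟩ : ∃ j, m = j + 2 := ⟨m - 2, by omega⟩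
    have hsub : (Finset.Icc 1 n).filter (· ∈ {k | ∃ j, k ∈ Ilac θ (R j)}) ⊆
        Finset.Icc 1 (θ (R j)) ∪ Ilac θ (R (j + 1)) := by
      intro k hk
      simp only [Finset.mem_filter, Finset.mem_Icc, Set.mem_setOf_eq] at hk
      obtain ⟨⟨hk1, hkn⟩, i, hi⟩ := hk
      rw [Finset.mem_union]
      rcases lt_trichotomy i (j + 1) with h | h | h
      · left
        simp only [Ilac, Finset.mem_Ioc] at hi
        have : θ (R i) ≤ θ (R j) := hm.monotone (hRm.monotone (by omega))
        simp only [Finset.mem_Icc]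
        omega
      · right
        rw [← h]; exact hi
      · exfalso
        simp only [Ilac, Finset.mem_Ioc] at hi
        have : θ (R (j + 2) - 1) ≤ θ (R i - 1) :=
          hm.monotone (Nat.sub_le_sub_right (hRm.monotone (by omega)) 1)
        omega
    have hcard := (Finset.card_le_card hsub).trans (Finset.card_union_le _ _)
    have hI : (Ilac θ (R (j + 1))).card = hgap θ (R (j + 1)) := by simp [Ilac, hgap]
    rw [hI, Nat.card_Icc, Nat.add_sub_cancel] at hcard
    have h3 := hm2 (j + 1) (by omega)
    obtain ⟨-, h4, h5⟩ := hR j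
    calc _ ≤ (j + 1) * (θ (R j) + hgap θ (R (j + 1))) := Nat.mul_le_mul (by omega) hcard
      _ = (j + 1) * θ (R j) + (j + 1) * hgap θ (R (j + 1)) := by ring
      _ ≤ 2 * n := by omega
  · rw [frequently_atTop]
    intro a
    exact ⟨R a, hRid a, fun k hk => ⟨a, hk⟩⟩

lemma aux_main_s12 (f : ℝ → ℝ) (hf : IsUnboundedModulus f) (hc : Compatible f)
    (θ : ℕ → ℕ) (hθ : IsLacunary θ) (hl : Filter.liminf (qratio θ) atTop = 1) :
    ∃ x : ℕ → ℝ, FStrongCesaro f x 0 ∧ ¬ LacFStrongCesaro f θ x 0 := by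
  obtain ⟨⟨hnn, hz, -, hmono, -⟩, -⟩ := hf
  obtain ⟨A, hA, hfr⟩ := aux_set θ hθ hl
  refine ⟨fun k => if k ∈ A then 1 else 0, ?_, ?_⟩
  · unfold FStrongCesaro
    have hsum : ∀ n : ℕ, ∑ k ∈ Finset.Icc 1 n, ‖(if k ∈ A then (1 : ℝ) else 0) - 0‖ =
        (((Finset.Icc 1 n).filter (· ∈ A)).card : ℝ) := by
      intro n
      rw [Finset.card_filter]
      push_cast
      refine Finset.sum_congr rfl fun k _ => ?_
      split_ifs <;> simp
    simp only [hsum]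
    rw [Metric.tendsto_atTop']
    intro η hη
    have hev : ∀ᶠ ε : ℝ in 𝓝[>] (0 : ℝ),
        Filter.limsup (fun n : ℕ => f ((n : ℝ) * ε) / f (n : ℝ)) atTop < η :=
      hc.eventually_lt_const hη
    have hev1 : ∀ᶠ ε : ℝ in 𝓝[>] (0 : ℝ), ε ∈ Set.Ioo (0 : ℝ) 1 :=
      Ioo_mem_nhdsGT one_pos
    obtain ⟨ε, hε, hε0, hε1⟩ := (hev.and hev1).exists
    have hbd : IsBoundedUnder (· ≤ ·) atTop (fun n : ℕ => f ((n : ℝ) * ε) / f (n : ℝ)) := by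
      refine isBoundedUnder_of ⟨1, fun n => ?_⟩
      have hn : (0 : ℝ) ≤ n := n.cast_nonneg
      exact div_le_one_of_le₀ (hmono _ _ (by positivity)
        (mul_le_of_le_one_right hn hε1.le)) (hnn _ hn)
    have hlt := eventually_lt_of_limsup_lt hε hbd
    obtain ⟨J, hJ⟩ := exists_nat_gt (2 / ε)
    obtain ⟨N, hN⟩ := eventually_atTop.mp (hlt.and (hA J))
    refine ⟨N, fun n hn => ?_⟩
    obtain ⟨h1, h2⟩ := hN n hn.le
    have hn0 : (0 : ℝ) ≤ n := n.cast_nonneg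
    set S : ℝ := (((Finset.Icc 1 n).filter (· ∈ A)).card : ℝ) with hS
    have hS0 : 0 ≤ S := by positivity
    have h2' : ((J : ℝ) + 1) * S ≤ 2 * n := by rw [hS]; exact_mod_cast h2
    have hJ' : 2 < J * ε := (div_lt_iff₀ hε0).mp hJ
    have hSle : S ≤ n * ε := by
      have : 2 * S ≤ 2 * (n * ε) := by
        calc 2 * S ≤ (J * ε) * S := by gcongr
          _ ≤ ε * ((J + 1) * S) := by nlinarith [mul_nonneg hε0.le hS0]
          _ ≤ ε * (2 * n) := by gcongr
          _ = _ := by ring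
      linarith
    rw [Real.dist_eq, sub_zero, abs_of_nonneg (div_nonneg (hnn _ hS0) (hnn _ hn0))]
    exact (div_le_div_of_nonneg_right (hmono _ _ hS0 hSle) (hnn _ hn0)).trans_lt h1
  · intro h
    unfold LacFStrongCesaro at h
    have hlt := h.eventually_lt_const (one_pos)
    obtain ⟨r, ⟨hr, hr1⟩, hr2⟩ := ((hfr.and_eventually hlt).and_eventually
      (eventually_ge_atTop 1)).exists
    have hs : ∑ k ∈ Ilac θ r, ‖(if k ∈ A then (1 : ℝ) else 0) - 0‖ = (hgap θ r : ℝ) := by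
      rw [Finset.sum_congr rfl (g := fun _ => (1 : ℝ))
        (fun k hk => by simp [hr k hk])]
      simp [Ilac, hgap]
    rw [hs] at hr1
    have hpos : 0 < hgap θ r := Nat.sub_pos_of_lt (hθ.2.1 (by omega))
    have hne : f (hgap θ r : ℝ) ≠ 0 := by
      rw [Ne, hz _ (Nat.cast_nonneg _)]
      exact_mod_cast hpos.ne'
    rw [div_self hne] at hr1
    exact lt_irrefl _ hr1

/-- For a compatible modulus `f`: if `liminf_r q_r = 1`, there is a real sequence which is
`f`-strong Cesàro convergent to `0` but not lacunary `f`-strong Cesàro convergent to `0`;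
consequently, if `f`-strong Cesàro convergence always implies lacunary `f`-strong Cesàro
convergence, then `liminf_r q_r > 1`. -/
theorem stmt12 (f : ℝ → ℝ) (hf : IsUnboundedModulus f) (hc : Compatible f)
    (θ : ℕ → ℕ) (hθ : IsLacunary θ) :
    (Filter.liminf (qratio θ) atTop = 1 →
      ∃ x : ℕ → ℝ, FStrongCesaro f x 0 ∧ ¬ LacFStrongCesaro f θ x 0) ∧
    ((∀ (x : ℕ → ℝ) (L : ℝ), FStrongCesaro f x L → LacFStrongCesaro f θ x L) →
      1 < Filter.liminf (qratio θ) atTop) := by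
  refine ⟨aux_main_s12 f hf hc θ hθ, fun h => ?_⟩
  have hge : 1 ≤ Filter.liminf (qratio θ) atTop := by
    refine le_liminf_of_le (by isBoundedDefault) ?_
    filter_upwards [eventually_ge_atTop 2] with r hr
    have hid : r - 1 ≤ θ (r - 1) := hθ.2.1.id_le _
    have hpos : θ (r - 1) ≠ 0 := by omega
    unfold qratio
    rw [ENNReal.le_div_iff_mul_le (Or.inl (by exact_mod_cast hpos)) (Or.inl (by simp)), one_mul]
    exact_mod_cast hθ.2.1.monotone (Nat.sub_le r 1)
  refine lt_of_le_of_ne hge fun heq => ?_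
  obtain ⟨x, hx, hx'⟩ := aux_main_s12 f hf hc θ hθ heq.symm
  exact hx' (h x 0 hx)
end

section
/- Let f be an unbounded modulus function which is compatible, i.e. lim_{ε→0⁺} limsup_{n→∞} f(nε)/f(n) = 0, and let θ = (k_r) be a lacunary sequence with h_r = k_r − k_{r−1}, I_r = (k_{r−1}, k_r] and ratios q_r = k_r/k_{r−1}. If limsup_r q_r < ∞, then for any normed space X and any sequence (x_n) in X which is lacunary f-strong Cesàro convergent to L ∈ X, i.e. lim_{r→∞} f(Σ_{k∈I_r} ‖x_k − L‖)/f(h_r) = 0, the sequence (x_n) is f-strong Cesàro convergent to L, i.e. lim_{n→∞} f(Σ_{k=1}^{n} ‖x_k − L‖)/f(n) = 0. -/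
open Filter Topology
open scoped Classical BigOperators

lemma modulus_nat_mul_s13 (f : ℝ → ℝ) (hf : IsModulusFunction f) (m : ℕ) (s : ℝ) (hs : 0 ≤ s) :
    f (m * s) ≤ m * f s := by
  obtain ⟨h0, hz, hadd, hmono, -⟩ := hf
  induction m with
  | zero => simp [(hz 0 le_rfl).2 rfl]
  | succ m ih =>
    have := hadd (m * s) s (by positivity) hs
    push_cast
    rw [add_mul, add_mul, one_mul, one_mul]
    linarith

lemma cesaro_eventually {a : ℕ → ℝ} (ha : ∀ n, 0 ≤ a n)
    (f : ℝ → ℝ) (hf : IsModulusFunction f)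
    (θ : ℕ → ℕ) (hθ : IsLacunary θ)
    (hq : Filter.limsup (qratio θ) atTop < ⊤)
    (h : Tendsto (fun r : ℕ => f (∑ k ∈ Ilac θ r, a k) / f (hgap θ r : ℝ)) atTop (𝓝 0))
    (ε : ℝ) (hε : 0 < ε) :
    ∀ᶠ n : ℕ in atTop, ∑ k ∈ Finset.Ioc 0 n, a k ≤ n * ε := by
  obtain ⟨hθ0, hmonoθ, hgapT⟩ := hθ
  -- bound on the ratios
  obtain ⟨K, hK⟩ := ENNReal.exists_nat_gt hq.ne
  have hK' := Filter.eventually_lt_of_limsup_lt hK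
  have hKr : ∀ᶠ r in atTop, θ r ≤ K * θ (r - 1) := by
    filter_upwards [hK', eventually_ge_atTop 2] with r hr h2
    have hpos : 0 < θ (r - 1) := by
      have := hmonoθ (show 0 < r - 1 by omega)
      omega
    unfold qratio at hr
    have h3 := (ENNReal.div_le_iff (by exact_mod_cast hpos.ne') (ENNReal.natCast_ne_top _)).1 hr.le
    exact_mod_cast h3
  obtain ⟨m, hm⟩ := exists_nat_gt (((K : ℝ) + 1) / ε)
  have hm0 : (0 : ℝ) < m := lt_of_le_of_lt (by positivity) hm
  have hmε : (K : ℝ) + 1 ≤ m * ε := by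
    rw [div_lt_iff₀ hε] at hm
    exact hm.le
  have hS : ∀ᶠ r in atTop, m * ∑ k ∈ Ilac θ r, a k ≤ (hgap θ r : ℝ) := by
    have h1 : ∀ᶠ r in atTop, f (∑ k ∈ Ilac θ r, a k) / f (hgap θ r : ℝ) < 1 / m :=
      h.eventually_lt_const (by positivity)
    filter_upwards [h1, hgapT.eventually_ge_atTop 1] with r hr hg
    by_contra! hlt
    have hg1 : (0 : ℝ) < hgap θ r := by
      have : 0 < hgap θ r := hg
      exact_mod_cast this
    have hs0 : 0 ≤ ∑ k ∈ Ilac θ r, a k := Finset.sum_nonneg fun k _ => ha k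
    have hfp : 0 < f (hgap θ r : ℝ) :=
      lt_of_le_of_ne (hf.1 _ hg1.le) fun e => hg1.ne' ((hf.2.1 _ hg1.le).1 e.symm)
    have h2 := hf.2.2.2.1 _ _ hg1.le hlt.le
    have h3 := modulus_nat_mul_s13 f hf m _ hs0
    rw [div_lt_div_iff₀ hfp hm0] at hr
    linarith
  obtain ⟨r0, hr0⟩ := (hS.and hKr).exists_forall_of_atTop
  have hT : ∀ r, r0 ≤ r → m * ∑ k ∈ Finset.Ioc 0 (θ r), a k
      ≤ m * ∑ k ∈ Finset.Ioc 0 (θ r0), a k + θ r := by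
    intro r hr
    induction r, hr using Nat.le_induction with
    | base => simp
    | succ r hr ih =>
      have h1 := (hr0 (r + 1) (by omega)).1
      have hle : θ r ≤ θ (r + 1) := hmonoθ.monotone (by omega)
      simp only [Ilac, hgap, Nat.add_sub_cancel, Nat.cast_sub hle] at h1
      rw [← Finset.sum_Ioc_consecutive a (Nat.zero_le _) hle]
      linarith
  obtain ⟨N, hN⟩ := exists_nat_ge (m * ∑ k ∈ Finset.Ioc 0 (θ r0), a k)
  filter_upwards [eventually_gt_atTop (θ r0), eventually_ge_atTop N] with n hn hnN
  have hex : ∃ r, n ≤ θ r := ⟨n, hmonoθ.le_apply⟩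
  obtain ⟨r, hr, hmin⟩ : ∃ r, n ≤ θ r ∧ ∀ s < r, θ s < n :=
    ⟨Nat.find hex, Nat.find_spec hex, fun s hs => not_le.1 (Nat.find_min hex hs)⟩
  have hrr : r0 < r := by
    by_contra! hcon
    have := hmonoθ.monotone hcon
    omega
  have h1 := hT r hrr.le
  have h2 : θ r ≤ K * n :=
    ((hr0 r hrr.le).2).trans (Nat.mul_le_mul_left _ (hmin (r - 1) (by omega)).le)
  have h2' : (θ r : ℝ) ≤ K * n := by exact_mod_cast h2
  have h3 : ∑ k ∈ Finset.Ioc 0 n, a k ≤ ∑ k ∈ Finset.Ioc 0 (θ r), a k :=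
    Finset.sum_le_sum_of_subset_of_nonneg (Finset.Ioc_subset_Ioc_right hr) fun k _ _ => ha k
  have h4 : (N : ℝ) ≤ n := by exact_mod_cast hnN
  have h5 := mul_le_mul_of_nonneg_left h3 hm0.le
  have h6 := mul_le_mul_of_nonneg_right hmε (Nat.cast_nonneg (α := ℝ) n)
  refine le_of_mul_le_mul_left ?_ hm0
  nlinarith

/-- For a compatible modulus `f`: if `limsup_r q_r < ∞`, then lacunary `f`-strong Cesàro
convergence implies `f`-strong Cesàro convergence. -/
theorem stmt13 {X : Type*} [NormedAddCommGroup X] [NormedSpace ℝ X]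
    (f : ℝ → ℝ) (hf : IsUnboundedModulus f) (hc : Compatible f)
    (θ : ℕ → ℕ) (hθ : IsLacunary θ)
    (hq : Filter.limsup (qratio θ) atTop < ⊤)
    (x : ℕ → X) (L : X) (h : LacFStrongCesaro f θ x L) :
    FStrongCesaro f x L := by
  have hm := hf.1
  obtain ⟨h0, hz, hadd, hmono, -⟩ := hf.1
  unfold FStrongCesaro
  have hs0 : ∀ n : ℕ, 0 ≤ ∑ k ∈ Finset.Icc 1 n, ‖x k - L‖ := fun n =>
    Finset.sum_nonneg fun k _ => norm_nonneg _
  rw [tendsto_order]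
  refine ⟨fun b hb => Eventually.of_forall fun n => hb.trans_le
    (div_nonneg (h0 _ (hs0 n)) (h0 _ (Nat.cast_nonneg n))), fun η hη => ?_⟩
  have hc1 : ∀ᶠ ε : ℝ in 𝓝[>] (0 : ℝ),
      Filter.limsup (fun n : ℕ => f ((n : ℝ) * ε) / f (n : ℝ)) atTop < η :=
    Tendsto.eventually_lt_const hη hc
  have hc2 : ∀ᶠ ε : ℝ in 𝓝[>] (0 : ℝ), ε ∈ Set.Ioo (0 : ℝ) 1 :=
    Ioo_mem_nhdsGT one_pos
  obtain ⟨ε, hlim, hε0, hε1⟩ := (hc1.and hc2).exists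
  have hbd : IsBoundedUnder (· ≤ ·) atTop (fun n : ℕ => f ((n : ℝ) * ε) / f (n : ℝ)) := by
    refine isBoundedUnder_of ⟨1, fun n => div_le_one_of_le₀ ?_ (h0 _ (Nat.cast_nonneg n))⟩
    exact hmono _ _ (by positivity) (mul_le_of_le_one_right (Nat.cast_nonneg n) hε1.le)
  have hev := Filter.eventually_lt_of_limsup_lt hlim hbd
  have hces := cesaro_eventually (a := fun k => ‖x k - L‖) (fun k => norm_nonneg _) f hm θ hθ hq h
    ε hε0
  filter_upwards [hev, hces] with n h1 h2
  refine lt_of_le_of_lt ?_ h1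
  exact div_le_div_of_nonneg_right (hmono _ _ (hs0 n) h2) (h0 _ (Nat.cast_nonneg n))
end

section
/- Let f be an unbounded modulus function and θ = (k_r) a lacunary sequence with h_r = k_r − k_{r−1}, I_r = (k_{r−1}, k_r] and ratios q_r = k_r/k_{r−1}. Assume f is θ-compatible, i.e. lim_{ε→0⁺} limsup_{r→∞} f(h_r ε)/f(h_r) = 0. If limsup_r q_r = ∞, then there exists a real sequence (x_n) which is lacunary f-strong Cesàro convergent to 0 but is not f-strong Cesàro convergent to any L ∈ ℝ. Consequently, if every lacunary f-strong Cesàro convergent real sequence is f-strong Cesàro convergent, then limsup_r q_r < ∞. -/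
open Filter Topology
open scoped Classical BigOperators

/-- `f (n) ≤ 4 f (n / 4)`. -/
theorem modulus_quarter {f : ℝ → ℝ} (hf : IsModulusFunction f) {s n : ℝ} (hn : 0 ≤ n)
    (hs : n / 4 ≤ s) : f n ≤ 4 * f s := by
  obtain ⟨_, _, h3, h4, _⟩ := hf
  have a := h4 (n / 4) s (by linarith) hs
  have b := h3 (n / 4) (n / 4) (by linarith) (by linarith)
  have c := h3 (n / 4 + n / 4) (n / 4 + n / 4) (by linarith) (by linarith)
  have e : n / 4 + n / 4 + (n / 4 + n / 4) = n := by ring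
  rw [e] at c
  linarith

theorem modulus_pos {f : ℝ → ℝ} (hf : IsModulusFunction f) {n : ℝ} (hn : 0 < n) : 0 < f n := by
  obtain ⟨h1, h2, _⟩ := hf
  refine lt_of_le_of_ne (h1 n hn.le) fun h => ?_
  exact hn.ne' ((h2 n hn.le).1 h.symm)

theorem not_fStrong {f : ℝ → ℝ} (hf : IsModulusFunction f) (x : ℕ → ℝ) (L : ℝ)
    (h : ∀ N : ℕ, ∃ n : ℕ, N ≤ n ∧ 0 < n ∧ (n : ℝ) / 4 ≤ ∑ k ∈ Finset.Icc 1 n, ‖x k - L‖) :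
    ¬ FStrongCesaro f x L := by
  intro hc
  have h1 := (hc.eventually (gt_mem_nhds (show (0 : ℝ) < 1 / 4 by norm_num)))
  obtain ⟨N, hN⟩ := eventually_atTop.1 h1
  obtain ⟨n, hn, hn0, hs⟩ := h N
  have h2 := hN n hn
  have hn0' : (0 : ℝ) < n := by exact_mod_cast hn0
  have hp := modulus_pos hf hn0'
  rw [div_lt_iff₀ hp] at h2
  have := modulus_quarter hf hn0'.le hs
  linarith

/-- strong lacunary smallness implies the `f`-version under compatibility. -/
theorem lac_of_small {f : ℝ → ℝ} (hf : IsModulusFunction f) {θ : ℕ → ℕ} (hθ : IsLacunary θ)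
    (hcomp : ThetaCompatible f θ) (s : ℕ → ℝ) (hs0 : ∀ r, 0 ≤ s r)
    (hs : ∀ ε : ℝ, 0 < ε → ∀ᶠ r in atTop, s r ≤ (hgap θ r : ℝ) * ε) :
    Tendsto (fun r : ℕ => f (s r) / f (hgap θ r : ℝ)) atTop (𝓝 0) := by
  have hnn : ∀ r, 0 ≤ f (hgap θ r : ℝ) := fun r => hf.1 _ (Nat.cast_nonneg _)
  rw [tendsto_order]
  refine ⟨fun a ha => Eventually.of_forall fun r =>
    lt_of_lt_of_le ha (div_nonneg (hf.1 _ (hs0 r)) (hnn r)), fun δ hδ => ?_⟩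
  have h1 := hcomp.eventually (gt_mem_nhds hδ)
  have h2 : ∀ᶠ ε : ℝ in 𝓝[>] (0 : ℝ), ε ∈ Set.Ioc (0 : ℝ) 1 :=
    Ioc_mem_nhdsGT one_pos
  obtain ⟨ε, hε, hε0, hε1⟩ := (h1.and h2).exists
  have hb : IsBoundedUnder (· ≤ ·) atTop
      (fun r : ℕ => f ((hgap θ r : ℝ) * ε) / f (hgap θ r : ℝ)) := by
    refine isBoundedUnder_of ⟨1, fun r => ?_⟩
    refine div_le_one_of_le₀ (hf.2.2.2.1 _ _ (by positivity) ?_) (hnn r)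
    exact mul_le_of_le_one_right (Nat.cast_nonneg _) hε1
  have h3 := eventually_lt_of_limsup_lt hε hb
  filter_upwards [h3, hs ε hε0] with r hr hr2
  refine lt_of_le_of_lt ?_ hr
  exact div_le_div_of_nonneg_right (hf.2.2.2.1 _ _ (hs0 r) hr2) (hnn r)

theorem exists_sub {θ : ℕ → ℕ} (hθ : IsLacunary θ) (h : limsup (qratio θ) atTop = ⊤) :
    ∃ φ : ℕ → ℕ, StrictMono φ ∧ ∀ j, 2 ≤ φ j ∧ (j + 4) * θ (φ j - 1) ≤ θ (φ j) := by
  apply extraction_forall_of_frequently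
    (P := fun j r => 2 ≤ r ∧ (j + 4) * θ (r - 1) ≤ θ r)
  intro j
  have h1 : ∃ᶠ r in atTop, ((j + 4 : ℕ) : ENNReal) < qratio θ r :=
    frequently_lt_of_lt_limsup (by isBoundedDefault) (by rw [h]; exact ENNReal.natCast_lt_top _)
  refine (h1.and_eventually (eventually_ge_atTop 2)).mono ?_
  rintro r ⟨hr, hr2⟩
  refine ⟨hr2, ?_⟩
  unfold qratio at hr
  have := ENNReal.mul_lt_of_lt_div hr
  have h2 : (j + 4) * θ (r - 1) < θ r := by exact_mod_cast this
  exact h2.le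

theorem block_index {θ φ : ℕ → ℕ} (hm : Monotone θ)
    (hφ : ∀ j, 2 ≤ φ j ∧ (j + 4) * θ (φ j - 1) ≤ θ (φ j)) {r i : ℕ}
    (h1 : θ (r - 1) < i) (h2 : i ≤ θ r)
    (hi : ∃ j, θ (φ j - 1) < i ∧ i ≤ 2 * θ (φ j - 1)) :
    ∃ j, r = φ j ∧ i ≤ 2 * θ (r - 1) := by
  obtain ⟨j, ha, hb⟩ := hi
  obtain ⟨hj2, hj⟩ := hφ j
  refine ⟨j, ?_⟩
  have e : r = φ j := by
    rcases lt_trichotomy r (φ j) with h | h | h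
    · have := hm (show r ≤ φ j - 1 by omega)
      omega
    · exact h
    · have := hm (show φ j ≤ r - 1 by omega)
      nlinarith
  subst e
  exact ⟨rfl, hb⟩

theorem stmt14_first (f : ℝ → ℝ) (hf : IsUnboundedModulus f) (θ : ℕ → ℕ) (hθ : IsLacunary θ)
    (hcomp : ThetaCompatible f θ) (h : Filter.limsup (qratio θ) atTop = ⊤) :
    ∃ x : ℕ → ℝ, LacFStrongCesaro f θ x 0 ∧ ∀ L : ℝ, ¬ FStrongCesaro f x L := by
  obtain ⟨φ, hmono, hφ⟩ := exists_sub hθ h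
  have hm : Monotone θ := hθ.2.1.monotone
  set A : ℕ → Prop := fun i => ∃ j, θ (φ j - 1) < i ∧ i ≤ 2 * θ (φ j - 1) with hA
  have hbig : ∀ j, j + 1 ≤ θ (φ j - 1) := by
    intro j
    have h1 : φ j - 1 ≤ θ (φ j - 1) := hθ.2.1.le_apply
    have h2 : ∀ j, j + 2 ≤ φ j := by
      intro j
      induction j with
      | zero => exact (hφ 0).1
      | succ n ih => have := hmono (show n < n + 1 by omega); omega
    have := h2 j
    omega
  refine ⟨fun i => if A i then 1 else 0, ?_, ?_⟩
  · refine lac_of_small hf.1 hθ hcomp _ (fun r => Finset.sum_nonneg fun _ _ => norm_nonneg _) ?_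
    intro ε hε
    obtain ⟨N, hN⟩ := exists_nat_gt (1 / ε)
    filter_upwards [eventually_ge_atTop (φ N)] with r hr
    by_cases hex : ∃ j, r = φ j
    · obtain ⟨j, rfl⟩ := hex
      have hNj : N ≤ j := hmono.le_iff_le.1 hr
      obtain ⟨hj2, hj⟩ := hφ j
      have hsum : ∑ k ∈ Ilac θ (φ j), ‖(if A k then (1 : ℝ) else 0) - 0‖ ≤ θ (φ j - 1) := by
        calc ∑ k ∈ Ilac θ (φ j), ‖(if A k then (1 : ℝ) else 0) - 0‖
            = ∑ k ∈ Ilac θ (φ j), (if A k then (1 : ℝ) else 0) := by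
              refine Finset.sum_congr rfl fun k _ => ?_
              split_ifs <;> simp
          _ = (((Ilac θ (φ j)).filter A).card : ℝ) := by
              rw [Finset.sum_boole]
          _ ≤ ((Finset.Ioc (θ (φ j - 1)) (2 * θ (φ j - 1))).card : ℝ) := by
              refine Nat.cast_le.2 (Finset.card_le_card fun k hk => ?_)
              rw [Finset.mem_filter, Ilac, Finset.mem_Ioc] at hk
              obtain ⟨_, _, hk3⟩ := block_index hm hφ hk.1.1 hk.1.2 hk.2
              exact Finset.mem_Ioc.2 ⟨hk.1.1, hk3⟩
          _ = θ (φ j - 1) := by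
              rw [Nat.card_Ioc]
              congr 1
              omega
      refine hsum.trans ?_
      have hg : (j + 3) * θ (φ j - 1) ≤ hgap θ (φ j) := by
        unfold hgap
        apply Nat.le_sub_of_add_le
        linarith
      have hg' : ((j : ℝ) + 3) * θ (φ j - 1) ≤ hgap θ (φ j) := by exact_mod_cast hg
      have hjN : (N : ℝ) ≤ j := by exact_mod_cast hNj
      rw [div_lt_iff₀ hε] at hN
      have h1 : 1 ≤ ((j : ℝ) + 3) * ε := by nlinarith
      have h0 : (0 : ℝ) ≤ θ (φ j - 1) := Nat.cast_nonneg _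
      calc (θ (φ j - 1) : ℝ) ≤ (((j : ℝ) + 3) * ε) * θ (φ j - 1) := le_mul_of_one_le_left h0 h1
        _ = (((j : ℝ) + 3) * θ (φ j - 1)) * ε := by ring
        _ ≤ _ := mul_le_mul_of_nonneg_right hg' hε.le
    · rw [Finset.sum_eq_zero]
      · positivity
      · intro k hk
        rw [Ilac, Finset.mem_Ioc] at hk
        have : ¬ A k := fun hk2 => by
          obtain ⟨j, hj, _⟩ := block_index hm hφ hk.1 hk.2 hk2
          exact hex ⟨j, hj⟩
        simp [this]
  · intro L
    apply not_fStrong hf.1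
    intro N
    have hb := hbig N
    obtain ⟨hj2, hj⟩ := hφ N
    have key : ∀ (a n : ℕ) (c : ℝ), (∀ k ∈ Finset.Ioc a n,
        (1 : ℝ) / 2 ≤ ‖(if A k then (1 : ℝ) else 0) - L‖) → 2 * a ≤ n →
        (n : ℝ) / 4 ≤ ∑ k ∈ Finset.Icc 1 n, ‖(if A k then (1 : ℝ) else 0) - L‖ := by
      intro a n c hk han
      have h1 : ∑ k ∈ Finset.Ioc a n, ‖(if A k then (1 : ℝ) else 0) - L‖ ≤
          ∑ k ∈ Finset.Icc 1 n, ‖(if A k then (1 : ℝ) else 0) - L‖ := by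
        apply Finset.sum_le_sum_of_subset_of_nonneg
        · intro k hk
          rw [Finset.mem_Ioc] at hk
          rw [Finset.mem_Icc]
          omega
        · intros; exact norm_nonneg _
      have h2 := Finset.card_nsmul_le_sum _ _ _ hk
      rw [Nat.card_Ioc, nsmul_eq_mul, Nat.cast_sub (by omega)] at h2
      have : (2 : ℝ) * a ≤ n := by exact_mod_cast han
      linarith
    by_cases hL : 1 / 2 ≤ |L|
    · have h4 : 4 * θ (φ N - 1) ≤ θ (φ N) := by nlinarith
      refine ⟨θ (φ N), by omega, by omega, key (2 * θ (φ N - 1)) _ 0 ?_ (by omega)⟩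
      intro k hk
      rw [Finset.mem_Ioc] at hk
      have : ¬ A k := fun hk2 => by
        obtain ⟨j, hj, h5⟩ := block_index hm hφ (r := φ N) (by omega) hk.2 hk2
        omega
      simpa [this] using hL
    · refine ⟨2 * θ (φ N - 1), by omega, by omega, key (θ (φ N - 1)) _ 0 ?_ le_rfl⟩
      intro k hk
      rw [Finset.mem_Ioc] at hk
      have : A k := ⟨N, hk⟩
      simp only [this, if_true, Real.norm_eq_abs]
      push Not at hL
      have := abs_lt.1 hL
      exact le_trans (by linarith) (le_abs_self _)

/-- For a `θ`-compatible modulus `f`: if `limsup_r q_r = ∞`, there is a real sequence which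
is lacunary `f`-strong Cesàro convergent to `0` but not `f`-strong Cesàro convergent to any
limit; consequently, if every lacunary `f`-strong Cesàro convergent real sequence is
`f`-strong Cesàro convergent, then `limsup_r q_r < ∞`. -/
theorem stmt14 (f : ℝ → ℝ) (hf : IsUnboundedModulus f) (θ : ℕ → ℕ) (hθ : IsLacunary θ)
    (hcomp : ThetaCompatible f θ) :
    (Filter.limsup (qratio θ) atTop = ⊤ →
      ∃ x : ℕ → ℝ, LacFStrongCesaro f θ x 0 ∧ ∀ L : ℝ, ¬ FStrongCesaro f x L) ∧
    ((∀ (x : ℕ → ℝ) (L : ℝ), LacFStrongCesaro f θ x L → ∃ L' : ℝ, FStrongCesaro f x L') →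
      Filter.limsup (qratio θ) atTop < ⊤) := by
  have h := stmt14_first f hf θ hθ hcomp
  refine ⟨h, fun hall => ?_⟩
  by_contra hc
  obtain ⟨x, hx, hn⟩ := h (not_lt_top_iff.1 hc)
  obtain ⟨L, hL⟩ := hall x 0 hx
  exact hn L hL
end

section
/- Let f be an unbounded modulus function which is compatible, i.e. lim_{ε→0⁺} limsup_{n→∞} f(nε)/f(n) = 0, and let θ = (k_r) be a lacunary sequence with h_r = k_r − k_{r−1}, I_r = (k_{r−1}, k_r] and ratios q_r = k_r/k_{r−1}. Then the following are equivalent: (a) for every real sequence (x_n) and every L ∈ ℝ, (x_n) is lacunary f-strong Cesàro convergent to L if and only if (x_n) is f-strong Cesàro convergent to L; (b) 1 < liminf_r q_r and limsup_r q_r < ∞. -/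
open Filter Topology
open scoped Classical BigOperators

namespace S15

/-- Compatible modulus: `f(a)/f(m) → 0` iff `a/m → 0`. -/
theorem reduce (f : ℝ → ℝ) (hf : IsUnboundedModulus f) (hc : Compatible f)
    (a : ℕ → ℝ) (ha : ∀ n, 0 ≤ a n) (m : ℕ → ℕ) (hm : Tendsto m atTop atTop) :
    Tendsto (fun n => f (a n) / f (m n : ℝ)) atTop (𝓝 0) ↔
      Tendsto (fun n => a n / (m n : ℝ)) atTop (𝓝 0) := by
  obtain ⟨⟨h0, hz, hsub, hmono, -⟩, -⟩ := hf
  have hpos : ∀ n : ℕ, 1 ≤ n → 0 < f (n : ℝ) := by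
    intro n hn
    have hn' : (0 : ℝ) < n := by exact_mod_cast hn
    refine lt_of_le_of_ne (h0 _ hn'.le) fun h => ?_
    exact hn'.ne' ((hz _ hn'.le).1 h.symm)
  have hmul : ∀ (K : ℕ) (x : ℝ), 0 ≤ x → f (K * x) ≤ K * f x := by
    intro K x hx
    induction K with
    | zero => simp [(hz 0 le_rfl).2 rfl]
    | succ K ih =>
      have := hsub (K * x) x (by positivity) hx
      push_cast
      rw [add_mul, one_mul, add_mul, one_mul]
      linarith
  constructor
  · intro h
    rw [Metric.tendsto_nhds] at h ⊢
    intro ε hε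
    obtain ⟨K, hK⟩ := exists_nat_one_div_lt hε
    filter_upwards [h (1 / ((K : ℝ) + 1)) (by positivity), hm.eventually_ge_atTop 1] with n h1 h2
    have hmp : (0 : ℝ) < m n := by exact_mod_cast h2
    have hfp := hpos _ h2
    rw [Real.dist_eq, sub_zero, abs_of_nonneg (div_nonneg (h0 _ (ha n)) hfp.le),
      div_lt_div_iff₀ hfp (by positivity)] at h1
    rw [Real.dist_eq, sub_zero, abs_of_nonneg (div_nonneg (ha n) hmp.le)]
    refine lt_of_le_of_lt ?_ hK
    by_contra hcon
    push Not at hcon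
    rw [div_lt_div_iff₀ (by positivity) hmp] at hcon
    have e1 := hmono (m n) (((K + 1 : ℕ) : ℝ) * a n) hmp.le (by push_cast; linarith)
    have e2 := hmul (K + 1) (a n) (ha n)
    push_cast at e1 e2
    linarith
  · intro h
    rw [Metric.tendsto_nhds] at h ⊢
    intro ε hε
    have hev := (hc.eventually (gt_mem_nhds hε)).and
      (Ioo_mem_nhdsGT (show (0 : ℝ) < 1 by norm_num))
    obtain ⟨δ, hδ, hδ0, hδ1⟩ := hev.exists
    have hb : IsBoundedUnder (· ≤ ·) atTop (fun n : ℕ => f ((n : ℝ) * δ) / f (n : ℝ)) := by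
      refine isBoundedUnder_of ⟨1, fun n => ?_⟩
      refine div_le_one_of_le₀ (hmono _ _ (by positivity) ?_) (h0 _ (by positivity))
      have : (0 : ℝ) ≤ n := by positivity
      nlinarith
    have hlt := eventually_lt_of_limsup_lt hδ hb
    filter_upwards [h δ hδ0, hm.eventually hlt, hm.eventually_ge_atTop 1] with n h1 h2 h3
    have hmp : (0 : ℝ) < m n := by exact_mod_cast h3
    have hfp := hpos _ h3
    rw [Real.dist_eq, sub_zero, abs_of_nonneg (div_nonneg (ha n) hmp.le), div_lt_iff₀ hmp] at h1
    rw [Real.dist_eq, sub_zero, abs_of_nonneg (div_nonneg (h0 _ (ha n)) hfp.le)]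
    refine lt_of_le_of_lt ?_ h2
    gcongr
    exact hmono _ _ (ha n) (by linarith)

theorem block_sum (θ : ℕ → ℕ) (hθ : IsLacunary θ) (a : ℕ → ℝ) (r : ℕ) :
    ∑ k ∈ Finset.Icc 1 (θ r), a k
      = ∑ k ∈ Finset.Icc 1 (θ (r - 1)), a k + ∑ k ∈ Ilac θ r, a k := by
  have hle : θ (r - 1) ≤ θ r := hθ.2.1.monotone (by omega)
  rw [Ilac, ← Finset.sum_union]
  · congr 1
    ext k; simp only [Finset.mem_union, Finset.mem_Icc, Finset.mem_Ioc]; omega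
  · rw [Finset.disjoint_left]
    intro k; simp only [Finset.mem_Icc, Finset.mem_Ioc]; omega

theorem gap_real (θ : ℕ → ℕ) (hθ : IsLacunary θ) (r : ℕ) :
    (hgap θ r : ℝ) = θ r - θ (r - 1) := by
  have hle : θ (r - 1) ≤ θ r := hθ.2.1.monotone (by omega)
  rw [hgap, Nat.cast_sub hle]

theorem c_to_n (θ : ℕ → ℕ) (hθ : IsLacunary θ) (a : ℕ → ℝ) (ha : ∀ n, 0 ≤ a n)
    (c : ℝ) (hc1 : 1 < c) (hc : ∀ᶠ r in atTop, c * θ (r - 1) ≤ θ r)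
    (h : Tendsto (fun n : ℕ => (∑ k ∈ Finset.Icc 1 n, a k) / (n : ℝ)) atTop (𝓝 0)) :
    Tendsto (fun r : ℕ => (∑ k ∈ Ilac θ r, a k) / (hgap θ r : ℝ)) atTop (𝓝 0) := by
  have h2 := (h.comp hθ.2.1.tendsto_atTop).mul_const (c / (c - 1))
  rw [zero_mul] at h2
  refine squeeze_zero' (Eventually.of_forall fun r =>
    div_nonneg (Finset.sum_nonneg fun k _ => ha k) (by positivity)) ?_ h2
  filter_upwards [hc, eventually_ge_atTop 1] with r hr hr1
  have hlt : θ (r - 1) < θ r := hθ.2.1 (by omega)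
  have hlt' : (θ (r - 1) : ℝ) < θ r := by exact_mod_cast hlt
  have hnn : (0 : ℝ) ≤ θ (r - 1) := by positivity
  have hg := gap_real θ hθ r
  have hb := block_sum θ hθ a r
  have hs1 : 0 ≤ ∑ k ∈ Finset.Icc 1 (θ (r - 1)), a k := Finset.sum_nonneg fun k _ => ha k
  have hs2 : 0 ≤ ∑ k ∈ Finset.Icc 1 (θ r), a k := Finset.sum_nonneg fun k _ => ha k
  simp only [Function.comp]
  rw [div_mul_div_comm, hg]
  have hc0 : 0 < c - 1 := by linarith
  have hp : (0 : ℝ) < θ r := by linarith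
  calc _ ≤ (∑ k ∈ Finset.Icc 1 (θ r), a k) / (θ r - θ (r - 1) : ℝ) := by
        exact (div_le_div_iff_of_pos_right (by linarith)).2 (by linarith)
    _ ≤ _ := by
        rw [div_le_div_iff₀ (by linarith) (by positivity)]
        have key : (θ r : ℝ) * (c - 1) ≤ c * (θ r - θ (r - 1)) := by nlinarith
        have := mul_le_mul_of_nonneg_left key hs2
        nlinarith

theorem n_to_c (θ : ℕ → ℕ) (hθ : IsLacunary θ) (a : ℕ → ℝ) (ha : ∀ n, 0 ≤ a n)
    (M : ℕ) (hM : ∀ᶠ r in atTop, θ r ≤ M * θ (r - 1))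
    (h : Tendsto (fun r : ℕ => (∑ k ∈ Ilac θ r, a k) / (hgap θ r : ℝ)) atTop (𝓝 0)) :
    Tendsto (fun n : ℕ => (∑ k ∈ Finset.Icc 1 n, a k) / (n : ℝ)) atTop (𝓝 0) := by
  rw [Metric.tendsto_nhds] at h ⊢
  intro ε hε
  set η := ε / (2 * (M + 1)) with hη
  have hη0 : 0 < η := by positivity
  obtain ⟨R, hR⟩ := eventually_atTop.1 ((h η hη0).and hM)
  have hmono : Monotone (fun n => ∑ k ∈ Finset.Icc 1 n, a k) := by
    intro m n hmn
    exact Finset.sum_le_sum_of_subset_of_nonneg (Finset.Icc_subset_Icc_right hmn)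
      fun k _ _ => ha k
  set C := ∑ k ∈ Finset.Icc 1 (θ R), a k with hC
  have hC0 : 0 ≤ C := Finset.sum_nonneg fun k _ => ha k
  have key : ∀ r, R ≤ r → ∑ k ∈ Finset.Icc 1 (θ r), a k ≤ C + η * θ r := by
    intro r hr
    induction r, hr using Nat.le_induction with
    | base => have : 0 ≤ η * θ R := by positivity
              linarith
    | succ r hr ih =>
      have hb := block_sum θ hθ a (r + 1)
      have hg := gap_real θ hθ (r + 1)
      have h1 := (hR (r + 1) (by omega)).1
      simp only [Nat.add_sub_cancel] at hb hg
      have hlt : (θ r : ℝ) < θ (r + 1) := by exact_mod_cast hθ.2.1 (Nat.lt_succ_self r)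
      rw [Real.dist_eq, sub_zero, hg] at h1
      have h2 := (le_abs_self _).trans_lt h1
      rw [div_lt_iff₀ (by linarith)] at h2
      linarith
  filter_upwards [eventually_gt_atTop (θ R), eventually_gt_atTop (Nat.ceil (2 * C / ε))]
    with n hn1 hn2
  have hn0 : (0 : ℝ) < n := by
    have : 0 < n := by omega
    exact_mod_cast this
  have hn2' : 2 * C / ε < n := (Nat.le_ceil _).trans_lt (by exact_mod_cast hn2)
  rw [div_lt_iff₀ hε] at hn2'
  have hex : ∃ r, n ≤ θ r := ⟨n, hθ.2.1.id_le n⟩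
  set r := Nat.find hex with hr
  have hr1 : n ≤ θ r := Nat.find_spec hex
  have hrR : R < r := by
    by_contra hcon
    have := hθ.2.1.monotone (not_lt.1 hcon)
    omega
  have hr2 : θ (r - 1) < n := not_le.1 (Nat.find_min hex (by omega : r - 1 < r))
  have h3 := key r hrR.le
  have h4 := (hR r hrR.le).2
  have h5 : (θ r : ℝ) ≤ M * θ (r - 1) := by exact_mod_cast h4
  have h6 : (θ (r - 1) : ℝ) ≤ n := by exact_mod_cast hr2.le
  have h7 := hmono hr1
  simp only at h7
  rw [Real.dist_eq, sub_zero, abs_of_nonneg (div_nonneg (Finset.sum_nonneg fun k _ => ha k) hn0.le),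
    div_lt_iff₀ hn0]
  have h8 : η * θ r ≤ ε / 2 * n := by
    calc η * θ r ≤ η * (M * n) := by gcongr; exact h5.trans (by gcongr)
      _ ≤ η * ((M + 1) * n) := by gcongr; linarith
      _ = ε / 2 * n := by rw [hη]; field_simp
  linarith

theorem liminf_freq (θ : ℕ → ℕ) (hθ : IsLacunary θ) (h : ¬ 1 < Filter.liminf (qratio θ) atTop)
    (K : ℕ) : ∃ᶠ r in atTop, K * hgap θ r ≤ θ (r - 1) := by
  intro hcon
  apply h
  have hK : 0 < K := by
    obtain ⟨r, hr⟩ := hcon.exists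
    rcases Nat.eq_zero_or_pos K with rfl | h
    · simp at hr
    · exact h
  have h1 : (1 : ENNReal) < ((1 + 1 / (K : NNReal) : NNReal) : ENNReal) := by
    have : (1 : NNReal) < 1 + 1 / (K : NNReal) := by
      have : (0 : NNReal) < 1 / (K : NNReal) := by positivity
      exact lt_add_of_pos_right _ this
    exact_mod_cast this
  refine h1.trans_le (le_liminf_of_le (by isBoundedDefault) ?_)
  filter_upwards [hcon, eventually_ge_atTop 2] with r hr hr2
  have hlt : θ (r - 1) < θ r := hθ.2.1 (by omega)
  have hp : 0 < θ (r - 1) := (Nat.zero_le _).trans_lt (hθ.2.1 (by omega : 0 < r - 1))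
  rw [qratio, ENNReal.le_div_iff_mul_le (Or.inl (by exact_mod_cast hp.ne'))
    (Or.inl (ENNReal.natCast_ne_top _))]
  have : (1 + 1 / (K : NNReal)) * (θ (r - 1) : NNReal) ≤ (θ r : NNReal) := by
    rw [← NNReal.coe_le_coe]
    push_cast
    have hg := gap_real θ hθ r
    have hr' : (θ (r - 1) : ℝ) < K * hgap θ r := by exact_mod_cast not_le.1 hr
    have hKr : (0 : ℝ) < K := by exact_mod_cast hK
    have : 1 / (K : ℝ) * θ (r - 1) ≤ hgap θ r := by
      rw [one_div_mul_eq_div, div_le_iff₀ hKr]; linarith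
    linarith
  exact_mod_cast this

theorem limsup_freq (θ : ℕ → ℕ) (h : ¬ Filter.limsup (qratio θ) atTop < ⊤)
    (M : ℕ) : ∃ᶠ r in atTop, M * θ (r - 1) ≤ θ r := by
  intro hcon
  apply h
  refine lt_of_le_of_lt (limsup_le_of_le (a := (M : ENNReal)) (by isBoundedDefault) ?_)
    (ENNReal.natCast_lt_top M)
  filter_upwards [hcon] with r hr
  refine ENNReal.div_le_of_le_mul ?_
  exact_mod_cast (not_le.1 hr).le

theorem liminf_ev (θ : ℕ → ℕ) (h : 1 < Filter.liminf (qratio θ) atTop) :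
    ∃ c : ℝ, 1 < c ∧ ∀ᶠ r in atTop, c * θ (r - 1) ≤ θ r := by
  obtain ⟨c, hc1, hc2⟩ := ENNReal.lt_iff_exists_nnreal_btwn.1 h
  refine ⟨c, by exact_mod_cast hc1, ?_⟩
  filter_upwards [eventually_lt_of_lt_liminf hc2] with r hr
  have h2 := ENNReal.mul_le_of_le_div hr.le
  have h3 : c * (θ (r - 1) : NNReal) ≤ (θ r : NNReal) := by exact_mod_cast h2
  exact_mod_cast h3

theorem limsup_ev (θ : ℕ → ℕ) (hθ : IsLacunary θ) (h : Filter.limsup (qratio θ) atTop < ⊤) :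
    ∃ M : ℕ, ∀ᶠ r in atTop, θ r ≤ M * θ (r - 1) := by
  obtain ⟨M, hM⟩ := ENNReal.exists_nat_gt h.ne
  refine ⟨M, ?_⟩
  filter_upwards [eventually_lt_of_limsup_lt hM, eventually_ge_atTop 2] with r hr hr2
  have hp : 0 < θ (r - 1) := (Nat.zero_le _).trans_lt (hθ.2.1 (by omega : 0 < r - 1))
  rw [qratio] at hr
  have h2 := (ENNReal.div_le_iff (by exact_mod_cast hp.ne') (ENNReal.natCast_ne_top _)).1 hr.le
  exact_mod_cast h2

/-- limsup infinite: a sequence that is lacunary convergent but not Cesaro convergent. -/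
theorem ex_limsup (θ : ℕ → ℕ) (hθ : IsLacunary θ)
    (h : ∀ M : ℕ, ∃ᶠ r in atTop, M * θ (r - 1) ≤ θ r) :
    ∃ a : ℕ → ℝ, (∀ n, 0 ≤ a n) ∧
      Tendsto (fun r : ℕ => (∑ k ∈ Ilac θ r, a k) / (hgap θ r : ℝ)) atTop (𝓝 0) ∧
      ¬ Tendsto (fun n : ℕ => (∑ k ∈ Finset.Icc 1 n, a k) / (n : ℝ)) atTop (𝓝 0) := by
  obtain ⟨φ, hφ, hφ2⟩ := extraction_forall_of_frequently
    (P := fun j r => (j + 2) * θ (r - 1) ≤ θ r ∧ 2 ≤ r)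
    (fun j => (h (j + 2)).and_eventually (eventually_ge_atTop 2))
  refine ⟨fun k => if ∃ j, k = θ (φ j - 1) + 1 then (k : ℝ) - 1 else 0, ?_, ?_, ?_⟩
  · intro k
    dsimp only
    split_ifs with hk
    · obtain ⟨j, rfl⟩ := hk
      push_cast; simp
    · exact le_rfl
  · rw [Metric.tendsto_nhds]
    intro ε hε
    obtain ⟨J, hJ⟩ := exists_nat_one_div_lt hε
    filter_upwards [eventually_ge_atTop (φ J), eventually_ge_atTop 1] with r hr hr1
    have hlt : θ (r - 1) < θ r := hθ.2.1 (by omega)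
    rw [Finset.sum_eq_single (θ (r - 1) + 1)]
    · split_ifs with hk
      · obtain ⟨j, hj⟩ := hk
        have hj2 : r - 1 = φ j - 1 := hθ.2.1.injective (by omega)
        have hj3 : r = φ j := by have := (hφ2 j).2; omega
        have hJj : J ≤ j := hφ.le_iff_le.1 (hj3 ▸ hr)
        have h1 := (hφ2 j).1
        rw [← hj3] at h1
        have h1' : ((j : ℝ) + 2) * θ (r - 1) ≤ θ r := by exact_mod_cast h1
        have hg := gap_real θ hθ r
        have hlt' : (θ (r - 1) : ℝ) < θ r := by exact_mod_cast hlt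
        have hJj' : (J : ℝ) ≤ j := by exact_mod_cast hJj
        have hnn : (0 : ℝ) ≤ θ (r - 1) := by positivity
        push_cast
        rw [add_sub_cancel_right, Real.dist_eq, sub_zero, hg,
          abs_of_nonneg (div_nonneg hnn (by linarith))]
        refine lt_of_le_of_lt ?_ hJ
        rw [div_le_div_iff₀ (by linarith) (by positivity)]
        nlinarith
      · simpa using hε
    · intro b hb hbne
      rw [if_neg]
      rintro ⟨j, rfl⟩
      rw [Ilac, Finset.mem_Ioc] at hb
      have h1 : θ (r - 1) < θ (φ j - 1) := by omega
      have h2 : θ (φ j - 1) < θ r := by omega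
      have := hθ.2.1.lt_iff_lt.1 h1
      have := hθ.2.1.lt_iff_lt.1 h2
      omega
    · intro hb
      exact absurd (Finset.mem_Ioc.2 ⟨by omega, by omega⟩) hb
  · intro hT
    have hT2 := hT.eventually (gt_mem_nhds (show (0 : ℝ) < 1 / 2 by norm_num))
    have hu : Tendsto (fun j => θ (φ j - 1) + 1) atTop atTop :=
      (tendsto_add_atTop_nat 1).comp
        (hθ.2.1.tendsto_atTop.comp ((tendsto_sub_atTop_nat 1).comp hφ.tendsto_atTop))
    obtain ⟨j, hj⟩ := (hu.eventually hT2).exists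
    have hp : 1 ≤ θ (φ j - 1) :=
      (Nat.zero_le _).trans_lt (hθ.2.1 (by have := (hφ2 j).2; omega : 0 < φ j - 1))
    set n := θ (φ j - 1) + 1 with hn
    have hn0 : (2 : ℝ) ≤ n := by exact_mod_cast (by omega : 2 ≤ n)
    have hS : (n : ℝ) - 1 ≤ ∑ k ∈ Finset.Icc 1 n,
        (if ∃ j, k = θ (φ j - 1) + 1 then (k : ℝ) - 1 else 0) := by
      have := Finset.single_le_sum (s := Finset.Icc 1 n)
        (f := fun k => if ∃ j, k = θ (φ j - 1) + 1 then (k : ℝ) - 1 else 0)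
        (fun k hk => by
          have : (1 : ℝ) ≤ k := by exact_mod_cast (Finset.mem_Icc.1 hk).1
          split_ifs
          · linarith
          · exact le_rfl) (Finset.mem_Icc.2 ⟨by omega, le_refl n⟩)
      refine le_trans ?_ this
      rw [if_pos ⟨j, hn⟩]
    rw [div_lt_iff₀ (by linarith)] at hj
    linarith

/-- liminf at most one: a Cesaro convergent sequence that is not lacunary convergent. -/
theorem ex_liminf (θ : ℕ → ℕ) (hθ : IsLacunary θ)
    (h : ∀ K : ℕ, ∃ᶠ r in atTop, K * hgap θ r ≤ θ (r - 1)) :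
    ∃ a : ℕ → ℝ, (∀ n, 0 ≤ a n) ∧
      Tendsto (fun n : ℕ => (∑ k ∈ Finset.Icc 1 n, a k) / (n : ℝ)) atTop (𝓝 0) ∧
      ¬ Tendsto (fun r : ℕ => (∑ k ∈ Ilac θ r, a k) / (hgap θ r : ℝ)) atTop (𝓝 0) := by
  have hθ1 : Tendsto (fun r => θ (r - 1)) atTop atTop :=
    hθ.2.1.tendsto_atTop.comp (tendsto_sub_atTop_nat 1)
  obtain ⟨φ, -, hφ⟩ := exists_seq_of_forall_finset_exists (fun _ : ℕ => True)
    (fun r r' => r < r' ∧ (r + 1) * hgap θ r' ≤ θ (r' - 1) ∧ (r + 1) * θ r ≤ θ (r' - 1))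
    (by
      intro s _
      set m := s.sup id
      obtain ⟨y, h1, h2, h3⟩ := ((h (m + 1)).and_eventually
        ((eventually_gt_atTop m).and (hθ1.eventually_ge_atTop ((m + 1) * θ m)))).exists
      refine ⟨y, trivial, fun x hx => ?_⟩
      have hxm : x ≤ m := Finset.le_sup (f := id) hx
      refine ⟨by omega, le_trans (by gcongr) h1, le_trans ?_ h3⟩
      have := hθ.2.1.monotone hxm
      gcongr)
  have hφm : StrictMono φ := fun m n hmn => (hφ m n hmn).1
  refine ⟨fun k => if ∃ j, k ∈ Ilac θ (φ j) then 1 else 0, ?_, ?_, ?_⟩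
  · intro k
    dsimp only
    split_ifs <;> norm_num
  · rw [Metric.tendsto_nhds]
    intro ε hε
    obtain ⟨K, hK⟩ := exists_nat_one_div_lt (half_pos hε)
    filter_upwards [eventually_gt_atTop (θ (φ (K + 1)))] with n hn
    have hex : ∃ j, n ≤ θ (φ (j + 1) - 1) := by
      have hu : Tendsto (fun j => θ (φ (j + 1) - 1)) atTop atTop :=
        hθ1.comp (hφm.tendsto_atTop.comp (tendsto_add_atTop_nat 1))
      exact (hu.eventually_ge_atTop n).exists
    set j := Nat.find hex with hj
    have hj1 : n ≤ θ (φ (j + 1) - 1) := Nat.find_spec hex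
    have hjK : K < j := by
      by_contra hcon
      have h1 : φ (j + 1) ≤ φ (K + 1) := hφm.monotone (by omega)
      have h2 := hθ.2.1.monotone (show φ (j + 1) - 1 ≤ φ (K + 1) by omega)
      omega
    have hj2 : θ (φ j - 1) < n := by
      have := not_le.1 (Nat.find_min hex (by omega : j - 1 < j))
      rwa [Nat.sub_add_cancel (by omega)] at this
    obtain ⟨-, g1, g2⟩ := hφ (j - 1) j (by omega)
    have hid : j - 1 ≤ φ (j - 1) := hφm.id_le _
    have hKj : K + 1 ≤ φ (j - 1) + 1 := by omega
    have g1' : (K + 1) * hgap θ (φ j) ≤ n := (Nat.mul_le_mul_right _ hKj).trans (g1.trans hj2.le)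
    have g2' : (K + 1) * θ (φ (j - 1)) ≤ n := (Nat.mul_le_mul_right _ hKj).trans (g2.trans hj2.le)
    have hS : (∑ k ∈ Finset.Icc 1 n, if ∃ j, k ∈ Ilac θ (φ j) then (1 : ℝ) else 0)
        ≤ θ (φ (j - 1)) + hgap θ (φ j) := by
      rw [Finset.sum_boole]
      have hsub : (Finset.Icc 1 n).filter (fun k => ∃ j, k ∈ Ilac θ (φ j))
          ⊆ Finset.Icc 1 (θ (φ (j - 1))) ∪ Ilac θ (φ j) := by
        intro k hk
        rw [Finset.mem_filter, Finset.mem_Icc] at hk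
        obtain ⟨⟨hk1, hkn⟩, i, hi⟩ := hk
        rw [Finset.mem_union, Finset.mem_Icc]
        rcases lt_trichotomy i j with hij | rfl | hij
        · left
          rw [Ilac, Finset.mem_Ioc] at hi
          exact ⟨hk1, hi.2.trans (hθ.2.1.monotone (hφm.monotone (by omega)))⟩
        · right; exact hi
        · exfalso
          rw [Ilac, Finset.mem_Ioc] at hi
          have h1 : φ (j + 1) ≤ φ i := hφm.monotone hij
          have h2 := hθ.2.1.monotone (show φ (j + 1) - 1 ≤ φ i - 1 by omega)
          omega
      have := (Finset.card_le_card hsub).trans (Finset.card_union_le _ _)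
      rw [Nat.card_Icc, Ilac, Nat.card_Ioc, Nat.add_sub_cancel] at this
      rw [hgap]
      exact_mod_cast this
    have hn0 : (0 : ℝ) < n := by
      have : 0 < n := by omega
      exact_mod_cast this
    have r1 : ((K : ℝ) + 1) * hgap θ (φ j) ≤ n := by exact_mod_cast g1'
    have r2 : ((K : ℝ) + 1) * θ (φ (j - 1)) ≤ n := by exact_mod_cast g2'
    have hS0 : 0 ≤ (∑ k ∈ Finset.Icc 1 n, if ∃ j, k ∈ Ilac θ (φ j) then (1 : ℝ) else 0) :=
      Finset.sum_nonneg fun k _ => by split_ifs <;> norm_num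
    rw [Real.dist_eq, sub_zero, abs_of_nonneg (div_nonneg hS0 hn0.le), div_lt_iff₀ hn0]
    rw [div_lt_iff₀ (by positivity)] at hK
    refine lt_of_le_of_lt hS ?_
    have hK1 : (0 : ℝ) < K + 1 := by positivity
    refine lt_of_mul_lt_mul_left ?_ hK1.le
    nlinarith
  · intro hT
    have hT2 := hT.eventually (gt_mem_nhds (show (0 : ℝ) < 1 by norm_num))
    obtain ⟨j, hj, hj1⟩ := ((hφm.tendsto_atTop.eventually hT2).and
      (hφm.tendsto_atTop.eventually_ge_atTop 1)).exists
    rw [Finset.sum_congr rfl (g := fun _ => (1 : ℝ)) (fun k hk => if_pos ⟨j, hk⟩)] at hj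
    have hlt : θ (φ j - 1) < θ (φ j) := hθ.2.1 (by omega)
    have hne : ((θ (φ j) - θ (φ j - 1) : ℕ) : ℝ) ≠ 0 := by
      exact_mod_cast (by omega : θ (φ j) - θ (φ j - 1) ≠ 0)
    rw [Finset.sum_const, nsmul_eq_mul, mul_one, Ilac, Nat.card_Ioc, hgap, div_self hne] at hj
    exact lt_irrefl _ hj

end S15

theorem stmt15 (f : ℝ → ℝ) (hf : IsUnboundedModulus f) (hc : Compatible f)
    (θ : ℕ → ℕ) (hθ : IsLacunary θ) :
    (∀ (x : ℕ → ℝ) (L : ℝ), LacFStrongCesaro f θ x L ↔ FStrongCesaro f x L) ↔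
      (1 < Filter.liminf (qratio θ) atTop ∧ Filter.limsup (qratio θ) atTop < ⊤) := by
  have e1 : ∀ (x : ℕ → ℝ) (L : ℝ), LacFStrongCesaro f θ x L ↔
      Tendsto (fun r : ℕ => (∑ k ∈ Ilac θ r, ‖x k - L‖) / (hgap θ r : ℝ)) atTop (𝓝 0) :=
    fun x L => S15.reduce f hf hc (fun r => ∑ k ∈ Ilac θ r, ‖x k - L‖)
      (fun r => Finset.sum_nonneg fun k _ => norm_nonneg _) (hgap θ) hθ.2.2
  have e2 : ∀ (x : ℕ → ℝ) (L : ℝ), FStrongCesaro f x L ↔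
      Tendsto (fun n : ℕ => (∑ k ∈ Finset.Icc 1 n, ‖x k - L‖) / (n : ℝ)) atTop (𝓝 0) :=
    fun x L => S15.reduce f hf hc (fun n => ∑ k ∈ Finset.Icc 1 n, ‖x k - L‖)
      (fun r => Finset.sum_nonneg fun k _ => norm_nonneg _) (fun n => n) tendsto_id
  simp only [e1, e2]
  constructor
  · intro H
    have H' : ∀ a : ℕ → ℝ, (∀ n, 0 ≤ a n) →
        (Tendsto (fun r : ℕ => (∑ k ∈ Ilac θ r, a k) / (hgap θ r : ℝ)) atTop (𝓝 0) ↔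
        Tendsto (fun n : ℕ => (∑ k ∈ Finset.Icc 1 n, a k) / (n : ℝ)) atTop (𝓝 0)) := by
      intro a ha
      have hn : ∀ k, ‖a k - 0‖ = a k := fun k => by
        rw [sub_zero, Real.norm_of_nonneg (ha k)]
      have := H a 0
      simpa only [hn] using this
    constructor
    · by_contra hcon
      obtain ⟨a, ha, h1, h2⟩ := S15.ex_liminf θ hθ (S15.liminf_freq θ hθ hcon)
      exact h2 ((H' a ha).2 h1)
    · by_contra hcon
      obtain ⟨a, ha, h1, h2⟩ := S15.ex_limsup θ hθ (S15.limsup_freq θ hcon)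
      exact h2 ((H' a ha).1 h1)
  · rintro ⟨h1, h2⟩ x L
    obtain ⟨c, hc1, hcc⟩ := S15.liminf_ev θ h1
    obtain ⟨M, hM⟩ := S15.limsup_ev θ hθ h2
    exact ⟨S15.n_to_c θ hθ _ (fun _ => norm_nonneg _) M hM,
      S15.c_to_n θ hθ _ (fun _ => norm_nonneg _) c hc1 hcc⟩
end

section
/- Let f be an unbounded modulus function, θ = (k_r) a lacunary sequence with h_r = k_r − k_{r−1} and I_r = (k_{r−1}, k_r], X a normed space, (x_n) a sequence in X, L ∈ X and m ≥ 1 a natural number. Then for every r, f(Σ_{k∈I_r} ‖x_k − L‖) ≥ (1/m) · f(#{k ∈ I_r : ‖x_k − L‖ ≥ 1/m}). In particular, if (x_n) is lacunary f-strong Cesàro convergent to L, then lim_{r→∞} f(#{k ∈ I_r : ‖x_k − L‖ ≥ 1/m})/f(h_r) = 0. -/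
open Filter Topology
open scoped Classical BigOperators

theorem modulus_nsmul_le (f : ℝ → ℝ) (hf : IsModulusFunction f) (y : ℝ) (hy : 0 ≤ y) (n : ℕ) :
    f (n * y) ≤ n * f y := by
  obtain ⟨_, h0, hsub, _, _⟩ := hf
  induction n with
  | zero => simp [(h0 0 le_rfl).2 rfl]
  | succ n ih =>
    have h := hsub (n * y) y (by positivity) hy
    have e : ((n + 1 : ℕ) : ℝ) * y = n * y + y := by push_cast; ring
    rw [e]
    push_cast
    linarith

/-- For every `r`, `f (Σ_{k ∈ I_r} ‖x_k - L‖) ≥ (1/m) · f (#{k ∈ I_r : ‖x_k - L‖ ≥ 1/m})`;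
in particular, lacunary `f`-strong Cesàro convergence to `L` forces
`f (#{k ∈ I_r : ‖x_k - L‖ ≥ 1/m}) / f (h_r) → 0`. -/
theorem stmt19 {X : Type*} [NormedAddCommGroup X] [NormedSpace ℝ X]
    (f : ℝ → ℝ) (hf : IsUnboundedModulus f) (θ : ℕ → ℕ) (hθ : IsLacunary θ)
    (x : ℕ → X) (L : X) (m : ℕ) (hm : 1 ≤ m) :
    (∀ r : ℕ,
      (1 / (m : ℝ)) *
          f ((((Ilac θ r).filter fun k => (1 : ℝ) / m ≤ ‖x k - L‖).card : ℝ)) ≤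
        f (∑ k ∈ Ilac θ r, ‖x k - L‖)) ∧
    (LacFStrongCesaro f θ x L →
      Tendsto (fun r : ℕ =>
          f ((((Ilac θ r).filter fun k => (1 : ℝ) / m ≤ ‖x k - L‖).card : ℝ)) /
            f (hgap θ r : ℝ)) atTop (𝓝 0)) := by
  have hm0 : (0 : ℝ) < m := by exact_mod_cast hm
  obtain ⟨hmod, _⟩ := hf
  have hmod' := hmod
  obtain ⟨hnn, _, _, hmono, _⟩ := hmod'
  have key : ∀ r : ℕ,
      f ((((Ilac θ r).filter fun k => (1 : ℝ) / m ≤ ‖x k - L‖).card : ℝ)) ≤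
        m * f (∑ k ∈ Ilac θ r, ‖x k - L‖) := by
    intro r
    set S := (Ilac θ r).filter fun k => (1 : ℝ) / m ≤ ‖x k - L‖ with hS
    have h1 : (S.card : ℝ) / m ≤ ∑ k ∈ Ilac θ r, ‖x k - L‖ := by
      calc (S.card : ℝ) / m = ∑ k ∈ S, (1 : ℝ) / m := by
            rw [Finset.sum_const, nsmul_eq_mul]; ring
        _ ≤ ∑ k ∈ S, ‖x k - L‖ :=
            Finset.sum_le_sum fun k hk => (Finset.mem_filter.1 hk).2
        _ ≤ ∑ k ∈ Ilac θ r, ‖x k - L‖ :=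
            Finset.sum_le_sum_of_subset_of_nonneg (Finset.filter_subset _ _)
              fun _ _ _ => norm_nonneg _
    have h2 := modulus_nsmul_le f hmod ((S.card : ℝ) / m) (by positivity) m
    rw [mul_div_cancel₀ _ hm0.ne'] at h2
    exact h2.trans (mul_le_mul_of_nonneg_left (hmono _ _ (by positivity) h1) hm0.le)
  refine ⟨fun r => ?_, fun h => ?_⟩
  · have h1 := mul_le_mul_of_nonneg_left (key r) (one_div_pos.2 hm0).le
    rwa [← mul_assoc, one_div_mul_cancel hm0.ne', one_mul] at h1
  · have h' := Tendsto.const_mul (m : ℝ) h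
    rw [mul_zero] at h'
    refine squeeze_zero (fun r => ?_) (fun r => ?_) h'
    · exact div_nonneg (hnn _ (Nat.cast_nonneg _)) (hnn _ (Nat.cast_nonneg _))
    · rw [← mul_div_assoc]
      exact div_le_div_of_nonneg_right (key r) (hnn _ (Nat.cast_nonneg _))
end
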